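/- arXiv:1008.1464 — 2 statements merged into one kernel-verified Lean document; each statement's English description precedes it below -/
import Mathlib

section
/- Let C be a cuspidal conjugacy class of a finite Coxeter group W. Then the elements of C_min form a single cyclic shift class: any two elements w, w' ∈ C_min satisfy w ↔ w', and every element of W that is ↔-equivalent to an element of C_min lies in C_min. -/
/-- The standard parabolic subgroup `W_I` of a Coxeter system, generated by the simple
reflections indexed by `I ⊆ S`. -/
def CoxeterSystem.parabolic {B W : Type*} [Group W] {M : CoxeterMatrix B}
    (cs : CoxeterSystem M W) (I : Set B) : Subgroup W :=
  Subgroup.closure (cs.simple '' I)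

/-- `C` is a conjugacy class of `W`. -/
def IsConjClassSet {W : Type*} [Group W] (C : Set W) : Prop :=
  ∃ w : W, C = {x | IsConj w x}

/-- The set of elements of minimal length in `C`. -/
def CoxeterSystem.Cmin {B W : Type*} [Group W] {M : CoxeterMatrix B}
    (cs : CoxeterSystem M W) (C : Set W) : Set W :=
  {w ∈ C | ∀ x ∈ C, cs.length w ≤ cs.length x}

/-- One step of the cyclic-shift pre-order: `y' = s * y * s` for some simple reflection `s`,
with `ℓ(y') ≤ ℓ(y)`. -/
def CoxeterSystem.CyclicShiftStep {B W : Type*} [Group W] {M : CoxeterMatrix B}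
    (cs : CoxeterSystem M W) (y y' : W) : Prop :=
  ∃ i : B, y' = cs.simple i * y * cs.simple i ∧ cs.length y' ≤ cs.length y

/-- The cyclic-shift pre-order `w → w'`. -/
def CoxeterSystem.CyclicShiftTo {B W : Type*} [Group W] {M : CoxeterMatrix B}
    (cs : CoxeterSystem M W) : W → W → Prop :=
  Relation.ReflTransGen cs.CyclicShiftStep

/-- The cyclic-shift equivalence `w ↔ w'` : `w → w'` and `w' → w`. -/
def CoxeterSystem.CyclicShiftEquiv {B W : Type*} [Group W] {M : CoxeterMatrix B}
    (cs : CoxeterSystem M W) (w w' : W) : Prop :=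
  cs.CyclicShiftTo w w' ∧ cs.CyclicShiftTo w' w

open scoped InnerProductSpace Topology NNReal

section Arrangement
variable {V : Type*} [NormedAddCommGroup V] [InnerProductSpace ℝ V]

/-- `x` lies on none of the hyperplanes orthogonal to the vectors of `A`. -/
def ArrRegular (A : Set V) (x : V) : Prop := ∀ a ∈ A, ⟪a, x⟫_ℝ ≠ 0

/-- `y` lies in the same chamber of `A` as `x`, or in an adjacent one, the wall `aᗮ` between them
separating the chamber of `x` from its image under `w` or `w⁻¹`. -/
def ArrStep (w : V ≃ₗᵢ[ℝ] V) (A : Set V) (x y : V) : Prop :=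
  (∀ b ∈ A, 0 < ⟪b, x⟫_ℝ * ⟪b, y⟫_ℝ) ∨
  ∃ a ∈ A, ⟪a, x⟫_ℝ * ⟪a, y⟫_ℝ < 0 ∧
    (∀ b ∈ A, (∃ c : ℝ, b = c • a) ∨ 0 < ⟪b, x⟫_ℝ * ⟪b, y⟫_ℝ) ∧
    (⟪a, x⟫_ℝ * ⟪a, w x⟫_ℝ < 0 ∨ ⟪a, x⟫_ℝ * ⟪a, w.symm x⟫_ℝ < 0)

/-- The preorder generated by `ArrStep`. -/
def ArrReach (w : V ≃ₗᵢ[ℝ] V) (A : Set V) : V → V → Prop :=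
  Relation.ReflTransGen (ArrStep w A)

/-- The path `γ` meets at most one hyperplane of `A` at time `t`, and it crosses this hyperplane
transversally, in a direction allowed by `ArrStep`. -/
def CrossesWell (w : V ≃ₗᵢ[ℝ] V) (A : Set V) (γ : ℝ → V) (t : ℝ) : Prop :=
  ∀ c ∈ A, ⟪c, γ t⟫_ℝ = 0 → (∀ d ∈ A, ⟪d, γ t⟫_ℝ = 0 → ∃ k : ℝ, d = k • c) ∧
    ∃ m : ℝ, m ≠ 0 ∧ HasDerivAt (fun s => ⟪c, γ s⟫_ℝ) m t ∧
      (0 < ⟪c, w (γ t)⟫_ℝ * m ∨ 0 < ⟪c, w.symm (γ t)⟫_ℝ * m ∨ w c = -c)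

theorem mul_pos_of_common {x y z : ℝ} (h1 : 0 < x * z) (h2 : 0 < y * z) : 0 < x * y := by
  by_contra h
  push Not at h
  have : 0 < (x * y) * (z * z) := by nlinarith [mul_pos h1 h2]
  nlinarith [mul_self_nonneg z]

theorem HasDerivAt.eventually_mul_pos {f : ℝ → ℝ} {m t : ℝ} (h : HasDerivAt f m t) (h0 : f t = 0)
    (hm : m ≠ 0) : ∀ᶠ s in 𝓝 t, s ≠ t → 0 < f s * (m * (s - t)) := by
  have h1 := hasDerivAt_iff_tendsto_slope.1 h
  have h2 : ∀ᶠ s in 𝓝[≠] t, 0 < slope f t s * m := by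
    have : Filter.Tendsto (fun s => slope f t s * m) (𝓝[≠] t) (𝓝 (m * m)) := h1.mul_const m
    exact this.eventually_const_lt (mul_self_pos.2 hm)
  rw [eventually_nhdsWithin_iff] at h2
  filter_upwards [h2] with s hs hne
  have h3 := hs hne
  have hst : s - t ≠ 0 := sub_ne_zero.2 hne
  rw [slope_def_field, h0, sub_zero] at h3
  have : f s * (m * (s - t)) = (f s / (s - t) * m) * ((s - t) * (s - t)) := by field_simp
  rw [this]
  exact mul_pos h3 (mul_self_pos.2 hst)

theorem CrossesWell.exists_local {w : V ≃ₗᵢ[ℝ] V} {A : Set V} (hA : A.Finite) {γ : ℝ → V}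
    (hγ : Continuous γ) {t : ℝ} (h : CrossesWell w A γ t) :
    ∃ ε > 0, (∀ s, |s - t| < ε → s ≠ t → ArrRegular A (γ s)) ∧
      ∀ s s', |s - t| < ε → |s' - t| < ε → s ≤ s' → ArrRegular A (γ s) → ArrRegular A (γ s') →
        ArrStep w A (γ s) (γ s') := by
  have hcont : ∀ c : V, Continuous fun s => ⟪c, γ s⟫_ℝ := fun c => continuous_const.inner hγ
  have hev : ∀ᶠ s in 𝓝 t, ∀ b ∈ A, ⟪b, γ t⟫_ℝ ≠ 0 → 0 < ⟪b, γ s⟫_ℝ * ⟪b, γ t⟫_ℝ := by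
    rw [Filter.eventually_all_finite hA]
    intro b _
    by_cases hb : ⟪b, γ t⟫_ℝ = 0
    · simp [hb]
    · have : Filter.Tendsto (fun s => ⟪b, γ s⟫_ℝ * ⟪b, γ t⟫_ℝ) (𝓝 t)
          (𝓝 (⟪b, γ t⟫_ℝ * ⟪b, γ t⟫_ℝ)) := ((hcont b).tendsto t).mul_const _
      filter_upwards [this.eventually_const_lt (mul_self_pos.2 hb)] with s hs _ using hs
  by_cases hreg : ArrRegular A (γ t)
  · obtain ⟨ε, hε, hball⟩ := Metric.eventually_nhds_iff.1 hev
    refine ⟨ε, hε, fun s hs _ b hb h0 => ?_, fun s s' hs hs' _ _ _ => Or.inl fun b hb => ?_⟩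
    · have := hball (by simpa [Real.dist_eq] using hs) b hb (hreg b hb)
      simp [h0] at this
    · exact mul_pos_of_common (hball (by simpa [Real.dist_eq] using hs) b hb (hreg b hb))
        (hball (by simpa [Real.dist_eq] using hs') b hb (hreg b hb))
  · simp only [ArrRegular, not_forall, not_not] at hreg
    obtain ⟨c, hc, hc0⟩ := hreg
    obtain ⟨hpar, m, hm, hder, hgood⟩ := h c hc hc0
    have hcross := hder.eventually_mul_pos hc0 hm
    have hwc : ∀ᶠ s in 𝓝 t, 0 < ⟪c, w (γ s)⟫_ℝ * m ∨ 0 < ⟪c, w.symm (γ s)⟫_ℝ * m ∨ w c = -c := by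
      rcases hgood with hg | hg | hg
      · have : Continuous fun s => ⟪c, w (γ s)⟫_ℝ * m :=
          (continuous_const.inner (w.continuous.comp hγ)).mul continuous_const
        filter_upwards [(this.tendsto t).eventually_const_lt hg] with s hs using Or.inl hs
      · have : Continuous fun s => ⟪c, w.symm (γ s)⟫_ℝ * m :=
          (continuous_const.inner (w.symm.continuous.comp hγ)).mul continuous_const
        filter_upwards [(this.tendsto t).eventually_const_lt hg] with s hs using Or.inr (Or.inl hs)
      · exact Filter.Eventually.of_forall fun _ => Or.inr (Or.inr hg)
    obtain ⟨ε, hε, hball⟩ := Metric.eventually_nhds_iff.1 (hev.and (hcross.and hwc))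
    have key : ∀ s, |s - t| < ε → _ := fun s hs => hball (by simpa [Real.dist_eq] using hs)
    have hzero : ∀ k : ℝ, ⟪k • c, γ t⟫_ℝ = 0 := fun k => by simp [inner_smul_left, hc0]
    refine ⟨ε, hε, fun s hs hst b hb h0 => ?_, fun s s' hs hs' hss hr hr' => ?_⟩
    · obtain ⟨k1, k2, -⟩ := key s hs
      by_cases hb0 : ⟪b, γ t⟫_ℝ = 0
      · obtain ⟨k, rfl⟩ := hpar b hb hb0
        have h3 := k2 hst
        rw [inner_smul_left] at h0
        rcases mul_eq_zero.1 h0 with h0 | h0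
        · have hk : k = 0 := by simpa using h0
          obtain ⟨k', hk'⟩ := (h _ hb hb0).1 c hc hc0
          rw [hk] at hk'
          simp only [zero_smul, smul_zero] at hk'
          rw [hk'] at h3
          simp at h3
        · rw [h0] at h3; simp at h3
      · have := k1 b hb hb0
        rw [h0] at this; simp at this
    · obtain ⟨k1, k2, k3⟩ := key s hs
      obtain ⟨k1', k2', -⟩ := key s' hs'
      have hst : s ≠ t := fun e => hr c hc (by rw [e, hc0])
      have hst' : s' ≠ t := fun e => hr' c hc (by rw [e, hc0])
      have k2 := k2 hst
      have k2' := k2' hst'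
      by_cases hside : s < t ∧ t < s'
      · obtain ⟨h1, h2⟩ := hside
        have e1 : ⟪c, γ s⟫_ℝ * m < 0 := by
          by_contra hcon; push Not at hcon; nlinarith
        have e2 : 0 < ⟪c, γ s'⟫_ℝ * m := by
          by_contra hcon; push Not at hcon; nlinarith
        have hm2 : 0 < m * m := mul_self_pos.2 hm
        have neg : ∀ x : ℝ, 0 < x * m → ⟪c, γ s⟫_ℝ * x < 0 := fun x hx => by
          by_contra hcon; push Not at hcon
          nlinarith [mul_pos_of_neg_of_neg e1 (neg_neg_of_pos hx)]
        refine Or.inr ⟨c, hc, neg _ e2, fun b hb => ?_, ?_⟩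
        · by_cases hb0 : ⟪b, γ t⟫_ℝ = 0
          · exact Or.inl (hpar b hb hb0)
          · exact Or.inr (mul_pos_of_common (k1 b hb hb0) (k1' b hb hb0))
        · rcases k3 with k3 | k3 | k3
          · exact Or.inl (neg _ k3)
          · exact Or.inr (neg _ k3)
          · left
            have : ⟪c, w (γ s)⟫_ℝ = - ⟪c, γ s⟫_ℝ := by
              have := w.inner_map_map c (γ s)
              rw [k3, inner_neg_left] at this
              linarith
            rw [this]
            linarith [mul_self_pos.2 (hr c hc)]
      · have hcc : 0 < ⟪c, γ s⟫_ℝ * ⟪c, γ s'⟫_ℝ := by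
          have hss : 0 < (s - t) * (s' - t) := by
            rcases lt_or_gt_of_ne hst with h1 | h1
            · have h2 : s' < t := lt_of_le_of_ne (not_lt.1 fun h => hside ⟨h1, h⟩) hst'
              exact mul_pos_of_neg_of_neg (by linarith) (by linarith)
            · exact mul_pos (by linarith) (by linarith)
          have h4 := mul_pos k2 k2'
          have h5 : ⟪c, γ s⟫_ℝ * (m * (s - t)) * (⟪c, γ s'⟫_ℝ * (m * (s' - t))) =
            (⟪c, γ s⟫_ℝ * ⟪c, γ s'⟫_ℝ) * ((m * m) * ((s - t) * (s' - t))) := by ring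
          rw [h5] at h4
          exact pos_of_mul_pos_left h4 (mul_nonneg (mul_self_nonneg m) hss.le)
        refine Or.inl fun b hb => ?_
        by_cases hb0 : ⟪b, γ t⟫_ℝ = 0
        · obtain ⟨k, rfl⟩ := hpar b hb hb0
          have hk : k ≠ 0 := by
            rintro rfl
            exact hr _ hb (by simp)
          simp only [inner_smul_left, conj_trivial]
          have : 0 < k * k := mul_self_pos.2 hk
          nlinarith [mul_pos this hcc]
        · exact mul_pos_of_common (k1 b hb hb0) (k1' b hb hb0)

theorem arrReach_of_path {w : V ≃ₗᵢ[ℝ] V} {A : Set V} (hA : A.Finite) {γ : ℝ → V}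
    (hγ : Continuous γ) {a b : ℝ} (hab : a ≤ b) (ha : ArrRegular A (γ a))
    (hb : ArrRegular A (γ b)) (H : ∀ t ∈ Set.Icc a b, CrossesWell w A γ t) :
    ArrReach w A (γ a) (γ b) := by
  let G : Set ℝ := {t | t ∈ Set.Icc a b ∧
    ∀ s ∈ Set.Icc a t, ArrRegular A (γ s) → ArrReach w A (γ a) (γ s)}
  have haG : a ∈ G := by
    refine ⟨⟨le_rfl, hab⟩, fun s hs _ => ?_⟩
    rw [le_antisymm hs.2 hs.1]
    exact Relation.ReflTransGen.refl
  have hbdd : BddAbove G := ⟨b, fun t ht => ht.1.2⟩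
  set c := sSup G with hc
  have hac : a ≤ c := le_csSup hbdd haG
  have hcb : c ≤ b := csSup_le ⟨a, haG⟩ fun t ht => ht.1.2
  obtain ⟨ε, hε, hreg, hstep⟩ := (H c ⟨hac, hcb⟩).exists_local hA hγ
  obtain ⟨s₀, hs₀a, hs₀, hs₀c, hs₀r, hreach, hinit⟩ : ∃ s₀, a ≤ s₀ ∧ |s₀ - c| < ε ∧ s₀ ≤ c ∧
      ArrRegular A (γ s₀) ∧ ArrReach w A (γ a) (γ s₀) ∧
      ∀ s ∈ Set.Icc a s₀, ArrRegular A (γ s) → ArrReach w A (γ a) (γ s) := by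
    rcases hac.eq_or_lt with h | h
    · refine ⟨a, le_rfl, by simpa [h] using hε, h.le, ha, Relation.ReflTransGen.refl, ?_⟩
      exact haG.2
    · obtain ⟨s₀, h1, h2⟩ := exists_between (max_lt h (sub_lt_self c hε))
      obtain ⟨g, hg, hgs⟩ := exists_lt_of_lt_csSup ⟨a, haG⟩ h2
      have h3 := (max_lt_iff.1 h1).1
      have h4 : |s₀ - c| < ε := by
        have := (max_lt_iff.1 h1).2
        rw [abs_lt]; constructor <;> linarith
      have h5 := hreg s₀ h4 h2.ne
      exact ⟨s₀, h3.le, h4, h2.le, h5, hg.2 s₀ ⟨h3.le, hgs.le⟩ h5,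
        fun s hs => hg.2 s ⟨hs.1, hs.2.trans hgs.le⟩⟩
  have hext : ∀ s, a ≤ s → s < c + ε → ArrRegular A (γ s) → ArrReach w A (γ a) (γ s) := by
    intro s hs hsc hsr
    rcases le_total s s₀ with h | h
    · exact hinit s ⟨hs, h⟩ hsr
    · refine hreach.tail (hstep s₀ s hs₀ ?_ h hs₀r hsr)
      rw [abs_lt] at hs₀ ⊢
      constructor <;> linarith
  by_cases hlt : b < c + ε
  · exact hext b hab hlt hb
  · exfalso
    have : c + ε / 2 ∈ G :=
      ⟨⟨by linarith, by linarith⟩, fun s hs => hext s hs.1 (by linarith [hs.2])⟩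
    linarith [le_csSup hbdd this]

/-- Two finite families of linear conditions can be avoided simultaneously inside an open set. -/
theorem exists_mem_open_inner_ne_zero (K : Submodule ℝ V) {F : Set V} (hF : F.Finite)
    (hne : ∀ f ∈ F, ∃ k ∈ K, ⟪f, k⟫_ℝ ≠ 0) {U : Set V} (hU : IsOpen U) {u : V} (hu : u ∈ U)
    (huK : u ∈ K) : ∃ y ∈ U, y ∈ K ∧ ∀ f ∈ F, ⟪f, y⟫_ℝ ≠ 0 := by
  induction F, hF using Set.Finite.induction_on with
  | empty => exact ⟨u, hu, huK, by simp⟩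
  | @insert f F _ _ ih =>
    obtain ⟨y, hyU, hyK, hy⟩ := ih fun g hg => hne g (Set.mem_insert_of_mem _ hg)
    obtain ⟨k, hk, hfk⟩ := hne f (Set.mem_insert _ _)
    have hcont : Continuous fun t : ℝ => y + t • k := by fun_prop
    have hopen : ∀ᶠ t : ℝ in 𝓝 0, y + t • k ∈ U ∧ ∀ g ∈ F, ⟪g, y + t • k⟫_ℝ ≠ 0 := by
      refine Filter.Eventually.and ?_ ?_
      · exact hcont.continuousAt.eventually_mem (hU.mem_nhds (by simpa using hyU))
      · rw [Filter.eventually_all_finite ‹F.Finite›]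
        intro g hg
        have : Continuous fun t : ℝ => ⟪g, y + t • k⟫_ℝ := by fun_prop
        exact this.continuousAt.eventually_ne (by simpa using hy g hg)
    have hf : ∀ᶠ t : ℝ in 𝓝[≠] 0, ⟪f, y + t • k⟫_ℝ ≠ 0 := by
      have hd : HasDerivAt (fun t : ℝ => ⟪f, y + t • k⟫_ℝ) ⟪f, k⟫_ℝ 0 := by
        simp only [inner_add_right, inner_smul_right]
        simpa using ((hasDerivAt_id (0 : ℝ)).mul_const ⟪f, k⟫_ℝ).const_add ⟪f, y⟫_ℝ
      exact hd.eventually_ne hfk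
    obtain ⟨t, ⟨h1, h2⟩, h3⟩ := ((hopen.filter_mono nhdsWithin_le_nhds).and hf).exists
    exact ⟨_, h1, K.add_mem hyK (K.smul_mem t hk), by simpa using ⟨h3, h2⟩⟩

/-- A segment between two points in general position connects their chambers. -/
theorem arrReach_of_segment {w : V ≃ₗᵢ[ℝ] V} {A : Set V} (hA : A.Finite) {x y : V}
    (hx : ArrRegular A x) (hy : ArrRegular A y)
    (hgen : ∀ a ∈ A, ∀ b ∈ A, (¬ ∃ k : ℝ, b = k • a) →
      ⟪a, x⟫_ℝ * ⟪b, y⟫_ℝ ≠ ⟪b, x⟫_ℝ * ⟪a, y⟫_ℝ)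
    (hgood : ∀ t ∈ Set.Icc (0 : ℝ) 1, ∀ a ∈ A, ⟪a, x + t • (y - x)⟫_ℝ = 0 →
      ⟪a, w (x + t • (y - x))⟫_ℝ * ⟪a, w.symm (x + t • (y - x))⟫_ℝ < 0 ∨ w a = -a) :
    ArrReach w A x y := by
  have h := arrReach_of_path (w := w) (γ := fun t : ℝ => x + t • (y - x)) hA (by fun_prop)
    zero_le_one (by simpa using hx) (by simpa using hy) ?_
  · simpa using h
  intro t ht c hc hc0
  refine ⟨fun d hd hd0 => ?_, ⟪c, y - x⟫_ℝ, ?_, ?_, ?_⟩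
  · by_contra hcon
    refine hgen c hc d hd hcon ?_
    have hcx := hx c hc
    simp only [inner_add_right, inner_smul_right, inner_sub_right] at hc0 hd0
    have ht0 : t ≠ 0 := by
      rintro rfl
      simp at hc0; exact hcx hc0
    have : t * (⟪c, x⟫_ℝ * ⟪d, y⟫_ℝ - ⟪d, x⟫_ℝ * ⟪c, y⟫_ℝ) = 0 := by
      linear_combination ⟪c, x⟫_ℝ * hd0 - ⟪d, x⟫_ℝ * hc0
    exact sub_eq_zero.1 ((mul_eq_zero.1 this).resolve_left ht0)
  · intro h0
    simp only [inner_add_right, inner_smul_right, h0] at hc0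
    exact hx c hc (by simpa using hc0)
  · simp only [inner_add_right, inner_smul_right]
    simpa using ((hasDerivAt_id t).mul_const ⟪c, y - x⟫_ℝ).const_add ⟪c, x⟫_ℝ
  · have hm : ⟪c, y - x⟫_ℝ ≠ 0 := by
      intro h0
      simp only [inner_add_right, inner_smul_right, h0] at hc0
      exact hx c hc (by simpa using hc0)
    rcases hgood t ht c hc hc0 with h | h
    · rcases lt_or_gt_of_ne hm with hm | hm
      · rcases mul_neg_iff.1 h with h | h
        · exact Or.inr (Or.inl (mul_pos_of_neg_of_neg h.2 hm))
        · exact Or.inl (mul_pos_of_neg_of_neg h.1 hm)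
      · rcases mul_neg_iff.1 h with h | h
        · exact Or.inl (mul_pos h.1 hm)
        · exact Or.inr (Or.inl (mul_pos h.2 hm))
    · exact Or.inr (Or.inr h)

theorem exists_mem_open_generic {A : Set V} (hA : A.Finite) {x : V} (hx : ArrRegular A x)
    {U : Set V} (hU : IsOpen U) {u : V} (hu : u ∈ U) :
    ∃ y ∈ U, ∀ a ∈ A, ∀ b ∈ A, (¬ ∃ k : ℝ, b = k • a) →
      ⟪a, x⟫_ℝ * ⟪b, y⟫_ℝ ≠ ⟪b, x⟫_ℝ * ⟪a, y⟫_ℝ := by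
  let F : Set V := ((fun p : V × V => ⟪p.1, x⟫_ℝ • p.2 - ⟪p.2, x⟫_ℝ • p.1) '' (A ×ˢ A)) \ {0}
  have hF : F.Finite := ((hA.prod hA).image _).sdiff
  obtain ⟨y, hyU, -, hy⟩ := exists_mem_open_inner_ne_zero ⊤ hF
    (fun f hf => ⟨f, trivial, by simpa using hf.2⟩) hU hu trivial
  refine ⟨y, hyU, fun a ha b hb hab h => ?_⟩
  have hne : ⟪a, x⟫_ℝ • b - ⟪b, x⟫_ℝ • a ≠ 0 := fun h0 => hab
    ⟨(⟪a, x⟫_ℝ)⁻¹ * ⟪b, x⟫_ℝ, by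
      rw [mul_smul, ← sub_eq_zero.1 h0, inv_smul_smul₀ (hx a ha)]⟩
  refine hy _ ⟨⟨(a, b), ⟨ha, hb⟩, rfl⟩, hne⟩ ?_
  simp only [inner_sub_left, inner_smul_left, conj_trivial]
  linarith

end Arrangement

section Flow
variable {V : Type*} [NormedAddCommGroup V] [InnerProductSpace ℝ V] {ι : Type*} [Fintype ι]

/-- The linear flow with eigenbasis `e` and exponents `lam`. -/
noncomputable def eigenFlow (e : OrthonormalBasis ι ℝ V) (lam : ι → ℝ) (t : ℝ) (x : V) : V :=
  ∑ i, (Real.exp (lam i * t) * ⟪e i, x⟫_ℝ) • e i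

theorem inner_basis_eigenFlow (e : OrthonormalBasis ι ℝ V) (lam : ι → ℝ) (t : ℝ) (x : V) (i : ι) :
    ⟪e i, eigenFlow e lam t x⟫_ℝ = Real.exp (lam i * t) * ⟪e i, x⟫_ℝ := by
  rw [eigenFlow, e.orthonormal.inner_right_fintype]

theorem inner_eigenFlow (e : OrthonormalBasis ι ℝ V) (lam : ι → ℝ) (t : ℝ) (x c : V) :
    ⟪c, eigenFlow e lam t x⟫_ℝ = ∑ i, Real.exp (lam i * t) * ⟪e i, x⟫_ℝ * ⟪c, e i⟫_ℝ := by
  simp [eigenFlow, inner_sum, inner_smul_right]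

theorem eigenFlow_neg_eigenFlow (e : OrthonormalBasis ι ℝ V) (lam : ι → ℝ) (t : ℝ) (x : V) :
    eigenFlow e lam (-t) (eigenFlow e lam t x) = x := by
  conv_rhs => rw [← e.sum_repr' x]
  rw [eigenFlow]
  refine Finset.sum_congr rfl fun i _ => ?_
  rw [inner_basis_eigenFlow, ← mul_assoc, ← Real.exp_add]
  simp

theorem eigenFlow_zero (e : OrthonormalBasis ι ℝ V) (lam : ι → ℝ) (x : V) :
    eigenFlow e lam 0 x = x := by
  simpa [eigenFlow] using e.sum_repr' x

theorem contDiff_eigenFlow (e : OrthonormalBasis ι ℝ V) (lam : ι → ℝ) :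
    ContDiff ℝ 1 fun p : ℝ × V => eigenFlow e lam p.1 p.2 := by
  unfold eigenFlow
  refine ContDiff.sum fun i _ => ContDiff.smul (ContDiff.mul ?_ ?_) contDiff_const
  · exact Real.contDiff_exp.comp (contDiff_const.mul contDiff_fst)
  · exact contDiff_const.inner ℝ contDiff_snd

theorem hasDerivAt_inner_eigenFlow (e : OrthonormalBasis ι ℝ V) (lam : ι → ℝ) (x c : V) (t : ℝ) :
    HasDerivAt (fun s => ⟪c, eigenFlow e lam s x⟫_ℝ)
      (∑ i, Real.exp (lam i * t) * lam i * ⟪e i, x⟫_ℝ * ⟪c, e i⟫_ℝ) t := by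
  simp only [inner_eigenFlow]
  refine HasDerivAt.fun_sum fun i _ => ?_
  have h : HasDerivAt (fun s : ℝ => lam i * s) (lam i) t := by
    simpa using (hasDerivAt_id t).const_mul (lam i)
  exact (h.exp.mul_const _).mul_const _

/-- For a generic starting point, the flow avoids finitely many subspaces of codimension two. -/
theorem dense_eigenFlow_avoid [FiniteDimensional ℝ V] (e : OrthonormalBasis ι ℝ V) (lam : ι → ℝ)
    {F : Set (V × V)} (hF : F.Finite) (hind : ∀ p ∈ F, LinearIndependent ℝ ![p.1, p.2]) :
    Dense {x : V | ∀ p ∈ F, ∀ t : ℝ,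
      ¬ (⟪p.1, eigenFlow e lam t x⟫_ℝ = 0 ∧ ⟪p.2, eigenFlow e lam t x⟫_ℝ = 0)} := by
  let N : V × V → Submodule ℝ V := fun p => (Submodule.span ℝ (Set.range ![p.1, p.2]))ᗮ
  let S : V × V → Set V := fun p => Set.range fun q : ℝ × N p => eigenFlow e lam q.1 q.2
  have hdim : ∀ p ∈ F, dimH (S p) ≤ ((Module.finrank ℝ V - 1 : ℕ) : ENNReal) ∧
      2 ≤ Module.finrank ℝ V := by
    intro p hp
    have h1 := finrank_span_eq_card (hind p hp)
    have h2 := (Submodule.span ℝ (Set.range ![p.1, p.2])).finrank_add_finrank_orthogonal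
    rw [h1, Fintype.card_fin] at h2
    have h3 : ContDiff ℝ 1 fun q : ℝ × N p => eigenFlow e lam q.1 q.2 :=
      (contDiff_eigenFlow e lam).comp
        (contDiff_fst.prodMk ((N p).subtypeL.contDiff.comp contDiff_snd))
    refine ⟨h3.dimH_range_le.trans ?_, by omega⟩
    rw [Module.finrank_prod, Module.finrank_self]
    have : Module.finrank ℝ (N p) = Module.finrank ℝ (Submodule.span ℝ (Set.range ![p.1, p.2]))ᗮ :=
      rfl
    exact_mod_cast (by omega)
  by_cases hne : F.Nonempty
  · obtain ⟨p₀, hp₀⟩ := hne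
    have h2 := (hdim p₀ hp₀).2
    have hlt : dimH (⋃ p ∈ F, S p) < Module.finrank ℝ V := by
      rw [dimH_bUnion hF.countable]
      refine lt_of_le_of_lt (iSup₂_le fun p hp => (hdim p hp).1) ?_
      exact_mod_cast (by omega)
    refine Dense.mono ?_ (dense_compl_of_dimH_lt_finrank hlt)
    intro x hx p hp t ht
    apply hx
    refine Set.mem_biUnion hp ⟨(-t, ⟨eigenFlow e lam t x, ?_⟩), eigenFlow_neg_eigenFlow e lam t x⟩
    rw [Submodule.mem_orthogonal]
    intro u hu
    induction hu using Submodule.span_induction with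
    | mem u hu =>
      obtain ⟨i, rfl⟩ := hu
      fin_cases i
      · exact ht.1
      · exact ht.2
    | zero => simp
    | add u v _ _ hu hv => rw [inner_add_left, hu, hv, add_zero]
    | smul k u _ hu => rw [inner_smul_left, hu, mul_zero]
  · rw [Set.not_nonempty_iff_eq_empty] at hne
    simp [hne]

theorem inner_map_add_symm (w : V ≃ₗᵢ[ℝ] V) (a v : V) :
    ⟪w a + w.symm a, v⟫_ℝ = ⟪a, w v + w.symm v⟫_ℝ := by
  rw [inner_add_left, inner_add_right, w.inner_map_eq_flip, w.symm.inner_map_eq_flip]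
  simp [add_comm]

theorem tendsto_inner_eigenFlow (e : OrthonormalBasis ι ℝ V) (lam : ι → ℝ) {l : ℝ} {a : V}
    (hl : ∀ i, l < lam i → ⟪a, e i⟫_ℝ = 0) (x : V) :
    Filter.Tendsto (fun t => Real.exp (-(l * t)) * ⟪a, eigenFlow e lam t x⟫_ℝ) Filter.atTop
      (𝓝 ⟪a, ∑ i with lam i = l, ⟪e i, x⟫_ℝ • e i⟫_ℝ) := by
  simp only [inner_eigenFlow, inner_sum, Finset.mul_sum, Finset.sum_filter]
  refine tendsto_finsetSum _ fun i _ => ?_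
  have heq : ∀ t, Real.exp (-(l * t)) * (Real.exp (lam i * t) * ⟪e i, x⟫_ℝ * ⟪a, e i⟫_ℝ) =
      Real.exp ((lam i - l) * t) * (⟪e i, x⟫_ℝ * ⟪a, e i⟫_ℝ) := fun t => by
    rw [← mul_assoc, ← mul_assoc, ← Real.exp_add, mul_assoc]; ring_nf
  simp only [heq]
  rcases lt_trichotomy (lam i) l with h | h | h
  · rw [if_neg h.ne]
    have : Filter.Tendsto (fun t => Real.exp ((lam i - l) * t)) Filter.atTop (𝓝 0) :=
      Real.tendsto_exp_atBot.comp (Filter.tendsto_id.const_mul_atTop_of_neg (by linarith))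
    simpa using this.mul_const (⟪e i, x⟫_ℝ * ⟪a, e i⟫_ℝ)
  · simp [h, inner_smul_right]
  · simp [h.ne', hl i h]

theorem exists_arrReach_eigenvector [FiniteDimensional ℝ V] (e : OrthonormalBasis ι ℝ V)
    {lam : ι → ℝ} {w : V ≃ₗᵢ[ℝ] V} (he : ∀ i, w (e i) + w.symm (e i) = lam i • e i)
    {A : Set V} (hA : A.Finite) {l : ℝ} (hl : ∀ a ∈ A, ∀ i, l < lam i → ⟪a, e i⟫_ℝ = 0)
    {x : V} (hx : ArrRegular A x) :
    ∃ y p, ArrRegular A y ∧ ArrReach w A x y ∧ w p + w.symm p = l • p ∧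
      ∀ a ∈ A, (∃ i, lam i = l ∧ ⟪a, e i⟫_ℝ ≠ 0) → 0 < ⟪a, y⟫_ℝ * ⟪a, p⟫_ℝ := by
  classical
  let P : V → V := fun x => ∑ i with lam i = l, ⟪e i, x⟫_ℝ • e i
  have hPsymm : ∀ a x, ⟪a, P x⟫_ℝ = ⟪P a, x⟫_ℝ := fun a x => by
    simp only [P, inner_sum, sum_inner, inner_smul_left, inner_smul_right, conj_trivial]
    refine Finset.sum_congr rfl fun i _ => ?_
    rw [real_inner_comm a (e i)]; ring
  -- the open conditions on the starting point
  let B : Set V := {a ∈ A | ∃ i, lam i = l ∧ ⟪a, e i⟫_ℝ ≠ 0}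
  have hBne : ∀ a ∈ B, P a ≠ 0 := by
    rintro a ⟨-, i, hi, hai⟩ h0
    apply hai
    have : ⟪e i, P a⟫_ℝ = ⟪e i, a⟫_ℝ := by
      simp only [P, Finset.sum_filter]
      have : ∀ j, (if lam j = l then ⟪e j, a⟫_ℝ • e j else 0) =
        (if lam j = l then ⟪e j, a⟫_ℝ else 0) • e j := fun j => by split_ifs <;> simp
      simp only [this]
      rw [e.orthonormal.inner_right_fintype, if_pos hi]
    rw [real_inner_comm, ← this, h0, inner_zero_right]
  let U : Set V := {z | ∀ a ∈ A, 0 < ⟪a, z⟫_ℝ * ⟪a, x⟫_ℝ}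
  have hUo : IsOpen U := by
    have : U = ⋂ a ∈ A, {z | 0 < ⟪a, z⟫_ℝ * ⟪a, x⟫_ℝ} := by ext; simp [U]
    rw [this]
    exact hA.isOpen_biInter fun a _ => isOpen_lt continuous_const (by fun_prop)
  have hxU : x ∈ U := fun a ha => mul_self_pos.2 (hx a ha)
  let U' : Set V := U ∩ {z | ∀ a ∈ B, ⟪P a, z⟫_ℝ ≠ 0}
  have hBf : B.Finite := hA.subset (Set.sep_subset _ _)
  have hU'o : IsOpen U' := by
    refine hUo.inter ?_
    have : {z | ∀ a ∈ B, ⟪P a, z⟫_ℝ ≠ 0} = ⋂ a ∈ B, {z | ⟪P a, z⟫_ℝ ≠ 0} := by ext; simp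
    rw [this]
    exact hBf.isOpen_biInter fun a _ =>
      isOpen_ne_fun (f := fun z : V => ⟪P a, z⟫_ℝ) (by fun_prop) continuous_const
  have hU'ne : U'.Nonempty := by
    obtain ⟨z, hzU, -, hz⟩ := exists_mem_open_inner_ne_zero ⊤ (hBf.image P)
      (by rintro _ ⟨a, ha, rfl⟩; exact ⟨P a, trivial, by simpa using hBne a ha⟩) hUo hxU trivial
    exact ⟨z, hzU, fun a ha => hz _ ⟨a, ha, rfl⟩⟩
  -- a generic starting point
  let A' : Set V := A ∪ (fun a => w a + w.symm a) '' A
  have hA' : A'.Finite := hA.union (hA.image _)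
  let F : Set (V × V) := {p | p ∈ A' ×ˢ A' ∧ LinearIndependent ℝ ![p.1, p.2]}
  have hF : F.Finite := (hA'.prod hA').subset fun p hp => hp.1
  obtain ⟨x₁, hx₁U, hx₁⟩ := (dense_eigenFlow_avoid e lam hF fun p hp => hp.2).inter_open_nonempty
    U' hU'o hU'ne
  have hne0 : ∀ a ∈ A, a ≠ 0 := fun a ha h => hx a ha (by simp [h])
  have hx₁r : ArrRegular A x₁ := fun a ha h0 => by
    have := hx₁U.1 a ha
    simp [h0] at this
  set γ : ℝ → V := fun t => eigenFlow e lam t x₁ with hγ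
  have hγc : Continuous γ := (contDiff_eigenFlow e lam).continuous.comp
    (continuous_id.prodMk continuous_const)
  have hTγ : ∀ c t, ⟪c, w (γ t) + w.symm (γ t)⟫_ℝ =
      ∑ i, Real.exp (lam i * t) * lam i * ⟪e i, x₁⟫_ℝ * ⟪c, e i⟫_ℝ := by
    intro c t
    rw [← inner_map_add_symm, hγ]
    simp only
    rw [inner_eigenFlow]
    refine Finset.sum_congr rfl fun i _ => ?_
    rw [inner_map_add_symm, he, inner_smul_right]; ring
  have hcross : ∀ t, CrossesWell w A γ t := by
    intro t c hc hc0
    have hpar : ∀ d ∈ A', ⟪d, γ t⟫_ℝ = 0 → ∃ k : ℝ, d = k • c := by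
      intro d hd hd0
      by_contra hcon
      push Not at hcon
      refine hx₁ (c, d) ⟨⟨Or.inl hc, hd⟩, ?_⟩ t ⟨hc0, hd0⟩
      exact (LinearIndependent.pair_iff' (hne0 c hc)).2 fun k hk => hcon k hk.symm
    have hm : ⟪c, w (γ t) + w.symm (γ t)⟫_ℝ ≠ 0 := by
      intro h0
      rw [← inner_map_add_symm] at h0
      obtain ⟨k, hk⟩ := hpar (w c + w.symm c) (Or.inr ⟨c, hc, rfl⟩) h0
      have hci : ∀ i, lam i * ⟪c, e i⟫_ℝ = k * ⟪c, e i⟫_ℝ := fun i => by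
        have := inner_map_add_symm w c (e i)
        rw [hk, he, inner_smul_left, inner_smul_right] at this
        simpa using this.symm
      refine hx₁r c hc ?_
      have hexp : ⟪c, γ t⟫_ℝ = Real.exp (k * t) * ⟪c, x₁⟫_ℝ := by
        rw [hγ]
        simp only
        rw [inner_eigenFlow, ← e.sum_inner_mul_inner c x₁, Finset.mul_sum]
        refine Finset.sum_congr rfl fun i _ => ?_
        by_cases h : ⟪c, e i⟫_ℝ = 0
        · simp [h]
        · rw [mul_right_cancel₀ h (hci i)]; ring
      rw [hexp] at hc0
      exact (mul_eq_zero.1 hc0).resolve_left (Real.exp_pos _).ne'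
    refine ⟨fun d hd => hpar d (Or.inl hd), _, hm, ?_, ?_⟩
    · rw [hTγ]
      exact hasDerivAt_inner_eigenFlow e lam x₁ c t
    · rw [inner_add_right] at hm ⊢
      by_contra hcon
      push Not at hcon
      nlinarith [mul_self_pos.2 hm]
  -- the limit of the flow
  have hlim : ∀ᶠ t in Filter.atTop, ∀ a ∈ B, 0 < ⟪a, γ t⟫_ℝ * ⟪a, P x₁⟫_ℝ := by
    rw [Filter.eventually_all_finite hBf]
    intro a ha
    have h1 := (tendsto_inner_eigenFlow e lam (hl a ha.1) x₁).mul_const ⟪a, P x₁⟫_ℝ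
    have h2 : ⟪a, P x₁⟫_ℝ ≠ 0 := by rw [hPsymm]; exact hx₁U.2 a ha
    filter_upwards [h1.eventually_const_lt (mul_self_pos.2 h2)] with t ht
    rw [mul_assoc] at ht
    exact pos_of_mul_pos_right ht (Real.exp_pos _).le
  obtain ⟨t₀, ht₀⟩ := Filter.eventually_atTop.1 hlim
  obtain ⟨ε, hε, hreg, -⟩ := (hcross (max t₀ 0)).exists_local hA hγc
  set t₁ := max t₀ 0 + ε / 2 with ht₁
  have ht₁r : ArrRegular A (γ t₁) :=
    hreg t₁ (by rw [ht₁, add_sub_cancel_left, abs_of_pos] <;> linarith) (by rw [ht₁]; linarith)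
  have hγ0 : γ 0 = x₁ := eigenFlow_zero e lam x₁
  refine ⟨γ t₁, P x₁, ht₁r, ?_, ?_, fun a ha hi => ht₀ t₁ ?_ a ⟨ha, hi⟩⟩
  · have h1 : ArrStep w A x x₁ := Or.inl fun b hb => by
      rw [mul_comm]; exact hx₁U.1 b hb
    have h2 := arrReach_of_path (w := w) hA hγc (a := 0) (b := t₁)
      (by linarith [le_max_right t₀ 0]) (by rwa [hγ0]) ht₁r fun t _ => hcross t
    rw [hγ0] at h2
    exact h2.head h1
  · simp only [P, map_sum, map_smul, Finset.smul_sum, ← Finset.sum_add_distrib]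
    refine Finset.sum_congr rfl fun i hi => ?_
    rw [← smul_add, he, (Finset.mem_filter.1 hi).2, smul_comm]
  · linarith [le_max_left t₀ 0]

end Flow

section Confluence
variable {V : Type*} [NormedAddCommGroup V] [InnerProductSpace ℝ V]

theorem eventually_add_smul_same_sign {A : Set V} (hA : A.Finite) {p : V}
    (hp : ∀ a ∈ A, ⟪a, p⟫_ℝ ≠ 0) (u : V) :
    ∀ᶠ ε : ℝ in 𝓝 0, ∀ a ∈ A, 0 < ⟪a, p + ε • u⟫_ℝ * ⟪a, p⟫_ℝ := by
  rw [Filter.eventually_all_finite hA]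
  intro a ha
  have hc : Continuous fun ε : ℝ => ⟪a, p + ε • u⟫_ℝ * ⟪a, p⟫_ℝ := by fun_prop
  exact (hc.tendsto 0).eventually_const_lt (by simpa using mul_self_pos.2 (hp a ha))

theorem ArrStep.eventually_add_smul {w : V ≃ₗᵢ[ℝ] V} {A A' : Set V} (hA : A.Finite)
    (hAA' : A' ⊆ A) {p : V} (hp : ∀ a ∈ A \ A', ⟪a, p⟫_ℝ ≠ 0)
    (hp0 : ∀ a ∈ A', ⟪a, p⟫_ℝ = 0 ∧ ⟪a, w p⟫_ℝ = 0 ∧ ⟪a, w.symm p⟫_ℝ = 0)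
    {u v : V} (h : ArrStep w A' u v) :
    ∀ᶠ ε : ℝ in 𝓝[>] 0, ArrStep w A (p + ε • u) (p + ε • v) := by
  have hfin : (A \ A').Finite := hA.subset Set.sdiff_subset
  filter_upwards [(eventually_add_smul_same_sign hfin hp u).filter_mono nhdsWithin_le_nhds,
    (eventually_add_smul_same_sign hfin hp v).filter_mono nhdsWithin_le_nhds,
    self_mem_nhdsWithin] with ε hu hv hε
  have hε : 0 < ε := hε
  have hin : ∀ a ∈ A', ∀ z, ⟪a, p + ε • z⟫_ℝ = ε * ⟪a, z⟫_ℝ := fun a ha z => by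
    rw [inner_add_right, inner_smul_right, (hp0 a ha).1, zero_add]
  have hinw : ∀ a ∈ A', ∀ z, ⟪a, w (p + ε • z)⟫_ℝ = ε * ⟪a, w z⟫_ℝ := fun a ha z => by
    rw [map_add, map_smul, inner_add_right, inner_smul_right, (hp0 a ha).2.1, zero_add]
  have hinw' : ∀ a ∈ A', ∀ z, ⟪a, w.symm (p + ε • z)⟫_ℝ = ε * ⟪a, w.symm z⟫_ℝ := fun a ha z => by
    rw [map_add, map_smul, inner_add_right, inner_smul_right, (hp0 a ha).2.2, zero_add]
  have hpos : ∀ s t : ℝ, 0 < s * t → 0 < ε * s * (ε * t) := fun s t h => by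
    have := mul_pos (mul_pos hε hε) h
    linarith
  have hneg : ∀ s t : ℝ, s * t < 0 → ε * s * (ε * t) < 0 := fun s t h => by
    have := mul_neg_of_pos_of_neg (mul_pos hε hε) h
    linarith
  have hout : ∀ b ∈ A, b ∉ A' → 0 < ⟪b, p + ε • u⟫_ℝ * ⟪b, p + ε • v⟫_ℝ := fun b hb hb' =>
    mul_pos_of_common (hu b ⟨hb, hb'⟩) (hv b ⟨hb, hb'⟩)
  rcases h with h | ⟨a, ha, h1, h2, h3⟩
  · refine Or.inl fun b hb => ?_
    by_cases hb' : b ∈ A'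
    · rw [hin b hb', hin b hb']
      exact hpos _ _ (h b hb')
    · exact hout b hb hb'
  · refine Or.inr ⟨a, hAA' ha, ?_, fun b hb => ?_, ?_⟩
    · rw [hin a ha, hin a ha]
      exact hneg _ _ h1
    · by_cases hb' : b ∈ A'
      · rw [hin b hb', hin b hb']
        exact (h2 b hb').imp_right (hpos _ _)
      · exact Or.inr (hout b hb hb')
    · rw [hin a ha, hinw a ha, hinw' a ha]
      exact h3.imp (hneg _ _) (hneg _ _)

theorem ArrReach.eventually_add_smul {w : V ≃ₗᵢ[ℝ] V} {A A' : Set V} (hA : A.Finite)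
    (hAA' : A' ⊆ A) {p : V} (hp : ∀ a ∈ A \ A', ⟪a, p⟫_ℝ ≠ 0)
    (hp0 : ∀ a ∈ A', ⟪a, p⟫_ℝ = 0 ∧ ⟪a, w p⟫_ℝ = 0 ∧ ⟪a, w.symm p⟫_ℝ = 0)
    {u v : V} (h : ArrReach w A' u v) :
    ∀ᶠ ε : ℝ in 𝓝[>] 0, ArrReach w A (p + ε • u) (p + ε • v) := by
  induction h with
  | refl => exact Filter.Eventually.of_forall fun _ => Relation.ReflTransGen.refl
  | tail _ h ih =>
    filter_upwards [ih, h.eventually_add_smul hA hAA' hp hp0] with ε h1 h2 using h1.tail h2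

/-- The `l`-eigenspace of `w + w⁻¹`. -/
def symmEigenspace (w : V ≃ₗᵢ[ℝ] V) (l : ℝ) : Submodule ℝ V where
  carrier := {v | w v + w.symm v = l • v}
  zero_mem' := by simp
  add_mem' := by
    intro a b ha hb
    simp only [Set.mem_ofPred_eq] at *
    rw [map_add, map_add, smul_add, ← ha, ← hb]; abel
  smul_mem' := by
    intro c a ha
    simp only [Set.mem_ofPred_eq] at *
    rw [map_smul, map_smul, ← smul_add, ha, smul_comm]

theorem mem_symmEigenspace {w : V ≃ₗᵢ[ℝ] V} {l : ℝ} {v : V} :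
    v ∈ symmEigenspace w l ↔ w v + w.symm v = l • v := Iff.rfl

theorem map_mem_symmEigenspace {w : V ≃ₗᵢ[ℝ] V} {l : ℝ} {v : V} (h : v ∈ symmEigenspace w l) :
    w v ∈ symmEigenspace w l := by
  rw [mem_symmEigenspace] at *
  rw [← map_smul, ← h, map_add]
  simp

theorem symm_mem_symmEigenspace {w : V ≃ₗᵢ[ℝ] V} {l : ℝ} {v : V} (h : v ∈ symmEigenspace w l) :
    w.symm v ∈ symmEigenspace w l := by
  rw [mem_symmEigenspace] at *
  rw [← map_smul, ← h, map_add]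
  simp

theorem exists_mem_symmEigenspace_inner_ne_zero [FiniteDimensional ℝ V] {w : V ≃ₗᵢ[ℝ] V} {l : ℝ}
    (hl : l ≠ 2) (hl' : l ≠ -2) {a p : V} (hp : p ∈ symmEigenspace w l) (hap : ⟪a, p⟫_ℝ ≠ 0) :
    ∃ k ∈ symmEigenspace w l, ⟪⟪a, p⟫_ℝ • w.symm a - ⟪w.symm a, p⟫_ℝ • a, k⟫_ℝ ≠ 0 := by
  by_contra! hcon
  obtain ⟨κ, hκ, z, hz, rfl⟩ := (symmEigenspace w l).exists_add_mem_mem_orthogonal a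
  have hzp : ∀ k ∈ symmEigenspace w l, ⟪z, k⟫_ℝ = 0 := fun k hk =>
    (Submodule.mem_orthogonal' _ z).1 hz k hk
  have hinner : ∀ k ∈ symmEigenspace w l, ⟪κ + z, k⟫_ℝ = ⟪κ, k⟫_ℝ := fun k hk => by
    rw [inner_add_left, hzp k hk, add_zero]
  have hinner' : ∀ k ∈ symmEigenspace w l, ⟪w.symm (κ + z), k⟫_ℝ = ⟪w.symm κ, k⟫_ℝ := fun k hk => by
    rw [w.symm.inner_map_eq_flip, w.symm.inner_map_eq_flip]
    exact hinner _ (map_mem_symmEigenspace hk)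
  rw [hinner p hp] at hap hcon
  set c := ⟪w.symm (κ + z), p⟫_ℝ
  have h0 : ⟪κ, p⟫_ℝ • w.symm κ - c • κ = 0 := by
    set f := ⟪κ, p⟫_ℝ • w.symm κ - c • κ with hf
    have hfK : f ∈ symmEigenspace w l := Submodule.sub_mem _
      (Submodule.smul_mem _ _ (symm_mem_symmEigenspace hκ)) (Submodule.smul_mem _ _ hκ)
    have := hcon f hfK
    rw [inner_sub_left, inner_smul_left, inner_smul_left, hinner f hfK, hinner' f hfK,
      ← inner_smul_left, ← inner_smul_left, ← inner_sub_left, ← hf] at this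
    exact inner_self_eq_zero.1 this
  have hκ0 : κ ≠ 0 := fun h => hap (by simp [h])
  obtain ⟨r, hr⟩ : ∃ r : ℝ, w.symm κ = r • κ := ⟨(⟪κ, p⟫_ℝ)⁻¹ * c, by
    rw [mul_smul, ← sub_eq_zero.1 h0, inv_smul_smul₀ hap]⟩
  have hr1 : r = 1 ∨ r = -1 := by
    have := w.symm.norm_map κ
    rw [hr, norm_smul] at this
    have h1 : ‖r‖ = 1 := by
      have h2 : (‖r‖ - 1) * ‖κ‖ = 0 := by linarith
      linarith [(mul_eq_zero.1 h2).resolve_right (norm_ne_zero_iff.2 hκ0)]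
    rwa [Real.norm_eq_abs, abs_eq zero_le_one] at h1
  have hwκ : κ = r • w κ := by
    rw [← map_smul, ← hr]; simp
  rw [mem_symmEigenspace, hr] at hκ
  rcases hr1 with rfl | rfl
  · rw [one_smul] at hwκ hκ
    rw [← hwκ, ← two_smul ℝ, ← sub_eq_zero, ← sub_smul] at hκ
    exact hl (by linarith [(smul_eq_zero.1 hκ).resolve_right hκ0])
  · have : w κ = -κ := by rw [neg_smul, one_smul] at hwκ; rw [eq_neg_iff_add_eq_zero]; nth_rewrite 2 [hwκ]; simp
    rw [this, neg_smul, one_smul, ← sub_eq_zero] at hκ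
    have h3 : (-2 - l) • κ = 0 := by rw [← hκ]; module
    exact hl' (by linarith [(smul_eq_zero.1 h3).resolve_right hκ0])

end Confluence

section Confluence
variable {V : Type*} [NormedAddCommGroup V] [InnerProductSpace ℝ V]

theorem isOpen_setOf_same_sign {A : Set V} (hA : A.Finite) (p : V) :
    IsOpen {z | ∀ a ∈ A, 0 < ⟪a, z⟫_ℝ * ⟪a, p⟫_ℝ} := by
  have : {z | ∀ a ∈ A, 0 < ⟪a, z⟫_ℝ * ⟪a, p⟫_ℝ} = ⋂ a ∈ A, {z | 0 < ⟪a, z⟫_ℝ * ⟪a, p⟫_ℝ} := by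
    ext; simp
  rw [this]
  exact hA.isOpen_biInter fun a _ =>
    isOpen_lt (g := fun z : V => ⟪a, z⟫_ℝ * ⟪a, p⟫_ℝ) continuous_const (by fun_prop)

/-- Within the chambers adjacent to an eigenspace of `w + w⁻¹`, one may move freely along the
eigenspace. -/
theorem exists_arrReach_along_symmEigenspace [FiniteDimensional ℝ V] {w : V ≃ₗᵢ[ℝ] V} {l : ℝ}
    (hl : l ≠ 2) (hl' : l ≠ -2) {A A' : Set V} (hA : A.Finite) (hAA' : A' ⊆ A)
    (hA' : ∀ a ∈ A', ∀ k ∈ symmEigenspace w l, ⟪a, k⟫_ℝ = 0) {p p' y : V}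
    (hpK : p ∈ symmEigenspace w l) (hpK' : p' ∈ symmEigenspace w l)
    (hp' : ∀ a ∈ A \ A', ⟪a, p'⟫_ℝ ≠ 0) (hy : ArrRegular A y)
    (hyp : ∀ a ∈ A \ A', 0 < ⟪a, y⟫_ℝ * ⟪a, p⟫_ℝ) :
    ∃ y₀, ArrReach w A y y₀ ∧ (∀ a ∈ A \ A', 0 < ⟪a, y₀⟫_ℝ * ⟪a, p'⟫_ℝ) ∧
      ∀ a ∈ A', 0 < ⟪a, y₀⟫_ℝ * ⟪a, y⟫_ℝ := by
  have hfin : (A \ A').Finite := hA.subset Set.sdiff_subset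
  have hfin' : A'.Finite := hA.subset hAA'
  have hp : ∀ a ∈ A \ A', ⟪a, p⟫_ℝ ≠ 0 := fun a ha h => by
    have := hyp a ha
    simp [h] at this
  obtain ⟨p₁, hp₁, hp₁K, hdet⟩ := exists_mem_open_inner_ne_zero (symmEigenspace w l)
    (hfin.image fun a => ⟪a, p⟫_ℝ • w.symm a - ⟪w.symm a, p⟫_ℝ • a)
    (by
      rintro _ ⟨a, ha, rfl⟩
      exact exists_mem_symmEigenspace_inner_ne_zero hl hl' hpK (hp a ha))
    (isOpen_setOf_same_sign hfin p') (fun a ha => mul_self_pos.2 (hp' a ha)) hpK'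
  have hp₁0 : ∀ a ∈ A \ A', ⟪a, p₁⟫_ℝ ≠ 0 := fun a ha h => by
    have := hp₁ a ha
    simp [h] at this
  let Ω : Set V := ⋂ a ∈ A \ A', {u | ⟪a, u⟫_ℝ ≠ 0} ∪ {u | ⟪a, w u⟫_ℝ * ⟪a, w.symm u⟫_ℝ < 0}
  have hΩ : IsOpen Ω := hfin.isOpen_biInter fun a _ =>
    (isOpen_ne_fun (f := fun u : V => ⟪a, u⟫_ℝ) (by fun_prop) continuous_const).union
      (isOpen_lt ((continuous_const.inner w.continuous).mul
        (continuous_const.inner w.symm.continuous)) continuous_const)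
  have hsegΩ : (fun t : ℝ => p + t • (p₁ - p)) '' Set.Icc 0 1 ⊆ Ω := by
    rintro _ ⟨t, ht, rfl⟩
    refine Set.mem_iInter₂.2 fun a ha => ?_
    by_cases h0 : ⟪a, p + t • (p₁ - p)⟫_ℝ = 0
    · right
      have hK : p + t • (p₁ - p) ∈ symmEigenspace w l :=
        Submodule.add_mem _ hpK (Submodule.smul_mem _ _ (Submodule.sub_mem _ hp₁K hpK))
      have hsum : ⟪a, w (p + t • (p₁ - p))⟫_ℝ + ⟪a, w.symm (p + t • (p₁ - p))⟫_ℝ = 0 := by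
        rw [← inner_add_right, mem_symmEigenspace.1 hK, inner_smul_right, h0, mul_zero]
      have hne : ⟪a, w (p + t • (p₁ - p))⟫_ℝ ≠ 0 := by
        intro h1
        rw [real_inner_comm, w.inner_map_eq_flip, real_inner_comm] at h1
        refine hdet _ ⟨a, ha, rfl⟩ ?_
        simp only [inner_sub_left, inner_smul_left, conj_trivial]
        simp only [inner_add_right, inner_smul_right, inner_sub_right] at h0 h1
        have ht0 : t ≠ 0 := by
          rintro rfl
          exact hp a ha (by linarith)
        have : t * (⟪a, p⟫_ℝ * ⟪w.symm a, p₁⟫_ℝ - ⟪w.symm a, p⟫_ℝ * ⟪a, p₁⟫_ℝ) = 0 := by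
          linear_combination ⟪a, p⟫_ℝ * h1 - ⟪w.symm a, p⟫_ℝ * h0
        exact (mul_eq_zero.1 this).resolve_left ht0
      have : ⟪a, w.symm (p + t • (p₁ - p))⟫_ℝ = -⟪a, w (p + t • (p₁ - p))⟫_ℝ := by linarith
      simp only [Set.mem_ofPred_eq]
      rw [this]
      nlinarith [mul_self_pos.2 hne]
    · exact Or.inl h0
  obtain ⟨η, hη, hthick⟩ := (isCompact_Icc.image (by fun_prop)).exists_thickening_subset_open
    hΩ hsegΩ
  have hsmall : ∀ᶠ δ : ℝ in 𝓝 0, ‖δ • y‖ < η / 2 := by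
    have : Continuous fun δ : ℝ => ‖δ • y‖ := by fun_prop
    exact (this.tendsto 0).eventually_lt_const (by simpa using hη)
  obtain ⟨δ, ⟨hδp, hδp₁, hδη⟩, hδ⟩ := ((((eventually_add_smul_same_sign hfin hp y).and
    ((eventually_add_smul_same_sign hfin hp₁0 y).and hsmall)).filter_mono
      nhdsWithin_le_nhds).and (self_mem_nhdsWithin (s := Set.Ioi 0))).exists
  have hδ : 0 < δ := hδ
  have hin : ∀ a ∈ A', ∀ k ∈ symmEigenspace w l, ⟪a, k + δ • y⟫_ℝ = δ * ⟪a, y⟫_ℝ :=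
    fun a ha k hk => by rw [inner_add_right, inner_smul_right, hA' a ha k hk, zero_add]
  have hposy : ∀ a ∈ A', 0 < δ * ⟪a, y⟫_ℝ * ⟪a, y⟫_ℝ := fun a ha => by
    rw [mul_assoc]
    exact mul_pos hδ (mul_self_pos.2 (hy a (hAA' ha)))
  have hstep : ∀ b ∈ A, 0 < ⟪b, y⟫_ℝ * ⟪b, p + δ • y⟫_ℝ := fun b hb => by
    by_cases hb' : b ∈ A'
    · rw [hin b hb' p hpK, mul_comm]
      exact hposy b hb'
    · exact mul_pos_of_common (hyp b ⟨hb, hb'⟩) (hδp b ⟨hb, hb'⟩)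
  have hx₀ : ArrRegular A (p + δ • y) := fun b hb h => by
    have := hstep b hb
    simp [h] at this
  obtain ⟨y₀, ⟨⟨hy₀1, hy₀2⟩, hy₀3⟩, hgen⟩ := exists_mem_open_generic hA hx₀
    (((isOpen_setOf_same_sign hfin p₁).inter (isOpen_setOf_same_sign hfin' y)).inter
      (Metric.isOpen_ball (x := p₁ + δ • y) (ε := η / 2))) (u := p₁ + δ • y)
    ⟨⟨hδp₁, fun a ha => by rw [hin a ha p₁ hp₁K]; exact hposy a ha⟩,
      Metric.mem_ball_self (by linarith)⟩
  have hy₀r : ArrRegular A y₀ := fun a ha h => by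
    by_cases ha' : a ∈ A'
    · have := hy₀2 a ha'
      simp [h] at this
    · have := hy₀1 a ⟨ha, ha'⟩
      simp [h] at this
  refine ⟨y₀, Relation.ReflTransGen.head (Or.inl hstep)
    (arrReach_of_segment hA hx₀ hy₀r hgen fun t ht a ha h0 => ?_), fun a ha => ?_, hy₀2⟩
  · left
    by_cases ha' : a ∈ A'
    · exfalso
      have h1 := hposy a ha'
      have h2 := hy₀2 a ha'
      rw [inner_add_right, inner_smul_right, inner_sub_right, hin a ha' p hpK] at h0
      have h3 : (1 - t) * (δ * ⟪a, y⟫_ℝ * ⟪a, y⟫_ℝ) + t * (⟪a, y₀⟫_ℝ * ⟪a, y⟫_ℝ) = 0 := by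
        linear_combination ⟪a, y⟫_ℝ * h0
      rcases ht.1.eq_or_lt with h | h
      · rw [← h] at h3
        linarith
      · nlinarith [mul_pos h h2, mul_nonneg (sub_nonneg.2 ht.2) h1.le]
    · have hz : p + δ • y + t • (y₀ - (p + δ • y)) ∈ Ω := by
        refine hthick (Metric.mem_thickening_iff.2 ⟨_, ⟨t, ht, rfl⟩, ?_⟩)
        have e : p + δ • y + t • (y₀ - (p + δ • y)) - (p + t • (p₁ - p)) =
          δ • y + t • (y₀ - (p₁ + δ • y)) := by module
        rw [dist_eq_norm, e]
        have h1 : ‖t • (y₀ - (p₁ + δ • y))‖ < η / 2 := by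
          rw [norm_smul, Real.norm_of_nonneg ht.1]
          rw [Metric.mem_ball, dist_eq_norm] at hy₀3
          nlinarith [ht.2, norm_nonneg (y₀ - (p₁ + δ • y))]
        linarith [norm_add_le (δ • y) (t • (y₀ - (p₁ + δ • y)))]
      exact (Set.mem_iInter₂.1 hz a ⟨ha, ha'⟩).resolve_left fun h => h h0
  · have := hp₁ a ha
    exact mul_pos_of_common (hy₀1 a ha) (by rwa [mul_comm])

end Confluence

section Confluence
variable {V : Type*} [NormedAddCommGroup V] [InnerProductSpace ℝ V]

theorem exists_orthonormalBasis_map_add_symm [FiniteDimensional ℝ V] (w : V ≃ₗᵢ[ℝ] V) :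
    ∃ (e : OrthonormalBasis (Fin (Module.finrank ℝ V)) ℝ V) (lam : Fin (Module.finrank ℝ V) → ℝ),
      ∀ i, w (e i) + w.symm (e i) = lam i • e i := by
  let T : V →ₗ[ℝ] V := w.toLinearEquiv.toLinearMap + w.symm.toLinearEquiv.toLinearMap
  have hT : T.IsSymmetric := fun x y => inner_map_add_symm w x y
  exact ⟨hT.eigenvectorBasis rfl, hT.eigenvalues rfl, hT.apply_eigenvectorBasis rfl⟩

theorem inner_map_eq_half {w : V ≃ₗᵢ[ℝ] V} {l : ℝ} {v : V} (h : w v + w.symm v = l • v) :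
    2 * ⟪w v, v⟫_ℝ = l * ⟪v, v⟫_ℝ := by
  have h1 : ⟪w v + w.symm v, v⟫_ℝ = l * ⟪v, v⟫_ℝ := by
    rw [h, inner_smul_left]; simp
  rw [inner_add_left, w.symm.inner_map_eq_flip, LinearIsometryEquiv.symm_symm,
    real_inner_comm (w v) v] at h1
  linarith

theorem map_eq_self_of_add_symm {w : V ≃ₗᵢ[ℝ] V} {v : V} (h : w v + w.symm v = (2 : ℝ) • v) :
    w v = v := by
  have h1 := inner_map_eq_half h
  have h2 : ⟪w v - v, w v - v⟫_ℝ = 0 := by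
    rw [real_inner_sub_sub_self, w.inner_map_map]; linarith
  exact sub_eq_zero.1 (inner_self_eq_zero.1 h2)

theorem map_eq_neg_of_add_symm {w : V ≃ₗᵢ[ℝ] V} {l : ℝ} {v : V} (h : w v + w.symm v = l • v)
    (hl : l ≤ -2) : w v = -v := by
  have h1 := inner_map_eq_half h
  have h2 : ⟪w v + v, w v + v⟫_ℝ = 0 := by
    refine le_antisymm ?_ real_inner_self_nonneg
    rw [real_inner_add_add_self, w.inner_map_map]
    nlinarith [real_inner_self_nonneg (x := v)]
  exact eq_neg_of_add_eq_zero_left (inner_self_eq_zero.1 h2)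

theorem ArrReach.of_same_chamber {w : V ≃ₗᵢ[ℝ] V} {A : Set V} {x y : V}
    (h : ∀ b ∈ A, 0 < ⟪b, x⟫_ℝ * ⟪b, y⟫_ℝ) : ArrReach w A x y :=
  Relation.ReflTransGen.single (Or.inl h)

/-- If all of `A` is negated by `w`, every chamber can be reached from every other one. -/
theorem arrReach_of_neg {w : V ≃ₗᵢ[ℝ] V} {A : Set V} (hA : A.Finite)
    (hw : ∀ a ∈ A, w a = -a) {x y : V} (hx : ArrRegular A x) (hy : ArrRegular A y) :
    ArrReach w A x y := by
  obtain ⟨z, hz, hgen⟩ := exists_mem_open_generic hA hx (isOpen_setOf_same_sign hA y)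
    (u := y) fun a ha => mul_self_pos.2 (hy a ha)
  have hzr : ArrRegular A z := fun a ha h => by
    have := hz a ha
    simp [h] at this
  exact (arrReach_of_segment hA hx hzr hgen fun t _ a ha _ => Or.inr (hw a ha)).trans
    (ArrReach.of_same_chamber hz)

/-- If `w` fixes no nonzero vector, any two chambers lead to a common one. -/
theorem exists_arrReach_common [FiniteDimensional ℝ V] {w : V ≃ₗᵢ[ℝ] V}
    (hw : ∀ v, w v = v → v = 0) {A : Set V} (hA : A.Finite) {x x' : V} (hx : ArrRegular A x)
    (hx' : ArrRegular A x') : ∃ z, ArrReach w A x z ∧ ArrReach w A x' z := by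
  classical
  obtain ⟨e, lam, he⟩ := exists_orthonormalBasis_map_add_symm w
  induction hn : A.ncard using Nat.strong_induction_on generalizing A x x' with
  | _ n ih =>
  let J : Finset (Fin (Module.finrank ℝ V)) := Finset.univ.filter fun i => ∃ a ∈ A, ⟪a, e i⟫_ℝ ≠ 0
  rcases A.eq_empty_or_nonempty with rfl | ⟨a₀, ha₀⟩
  · exact ⟨x', ArrReach.of_same_chamber (by simp), Relation.ReflTransGen.refl⟩
  have hJ : J.Nonempty := by
    by_contra hcon
    rw [Finset.not_nonempty_iff_eq_empty] at hcon
    have h1 : ∀ i, ⟪a₀, e i⟫_ℝ = 0 := fun i => by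
      by_contra h
      have : i ∈ J := by simp only [J, Finset.mem_filter, Finset.mem_univ, true_and]; exact ⟨_, ha₀, h⟩
      simp [hcon] at this
    refine hx a₀ ha₀ ?_
    rw [← e.sum_inner_mul_inner a₀ x]
    simp [h1]
  obtain ⟨i₀, hi₀, hmax⟩ := J.exists_max_image lam hJ
  set l := lam i₀ with hl_def
  have hl : ∀ a ∈ A, ∀ i, l < lam i → ⟪a, e i⟫_ℝ = 0 := fun a ha i hi => by
    by_contra h
    exact absurd (hmax i (by simp only [J, Finset.mem_filter, Finset.mem_univ, true_and]
                             exact ⟨a, ha, h⟩)) (not_le.2 hi)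
  have hi₀ : ∃ a ∈ A, ⟪a, e i₀⟫_ℝ ≠ 0 := by simpa [J] using hi₀
  by_cases hl' : l = -2
  · have hneg : ∀ a ∈ A, w a = -a := fun a ha => by
      conv_lhs => rw [← e.sum_repr' a]
      conv_rhs => rw [← e.sum_repr' a]
      rw [map_sum, ← Finset.sum_neg_distrib]
      refine Finset.sum_congr rfl fun i _ => ?_
      rw [map_smul]
      by_cases h : ⟪a, e i⟫_ℝ = 0
      · rw [real_inner_comm, h]; simp
      · have : lam i ≤ -2 := by
          rw [← hl']
          by_contra hc
          exact h (hl a ha i (not_le.1 hc))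
        rw [map_eq_neg_of_add_symm (he i) this, smul_neg]
    exact ⟨x', arrReach_of_neg hA hneg hx hx', Relation.ReflTransGen.refl⟩
  have hl2 : l ≠ 2 := fun h => by
    have h1 := he i₀
    rw [← hl_def, h] at h1
    exact e.orthonormal.ne_zero i₀ (hw _ (map_eq_self_of_add_symm h1))
  let A' : Set V := {a ∈ A | ∀ i, lam i = l → ⟪a, e i⟫_ℝ = 0}
  have hAA' : A' ⊆ A := Set.sep_subset _ _
  have hoff : ∀ a ∈ A \ A', ∃ i, lam i = l ∧ ⟪a, e i⟫_ℝ ≠ 0 := fun a ha => by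
    by_contra! h
    exact ha.2 ⟨ha.1, h⟩
  have hA'K : ∀ a ∈ A', ∀ k ∈ symmEigenspace w l, ⟪a, k⟫_ℝ = 0 := fun a ha k hk => by
    rw [← e.sum_inner_mul_inner a k]
    refine Finset.sum_eq_zero fun i _ => ?_
    by_cases hi : lam i = l
    · rw [ha.2 i hi, zero_mul]
    · have h1 := inner_map_add_symm w (e i) k
      rw [he, mem_symmEigenspace.1 hk, inner_smul_left, inner_smul_right] at h1
      have h2 : (lam i - l) * ⟪e i, k⟫_ℝ = 0 := by
        simp only [conj_trivial] at h1
        linarith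
      rw [(mul_eq_zero.1 h2).resolve_left (sub_ne_zero.2 hi), mul_zero]
  obtain ⟨y, p, hy, hxy, hpK, hyp⟩ := exists_arrReach_eigenvector e he hA hl hx
  obtain ⟨y', p', hy', hxy', hpK', hyp'⟩ := exists_arrReach_eigenvector e he hA hl hx'
  replace hyp : ∀ a ∈ A \ A', 0 < ⟪a, y⟫_ℝ * ⟪a, p⟫_ℝ := fun a ha => hyp a ha.1 (hoff a ha)
  replace hyp' : ∀ a ∈ A \ A', 0 < ⟪a, y'⟫_ℝ * ⟪a, p'⟫_ℝ := fun a ha => hyp' a ha.1 (hoff a ha)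
  have hp' : ∀ a ∈ A \ A', ⟪a, p'⟫_ℝ ≠ 0 := fun a ha h => by
    have := hyp' a ha
    simp [h] at this
  obtain ⟨y₀, hyy₀, hy₀p', hy₀y⟩ := exists_arrReach_along_symmEigenspace hl2 hl' hA hAA' hA'K
    hpK hpK' hp' hy hyp
  have hcard : A'.ncard < n := by
    rw [← hn]
    refine Set.ncard_lt_ncard ⟨hAA', fun h => ?_⟩ hA
    obtain ⟨a, ha, hai⟩ := hi₀
    exact hai ((h ha).2 i₀ rfl)
  have hy₀r : ArrRegular A' y₀ := fun a ha h => by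
    have := hy₀y a ha
    simp [h] at this
  obtain ⟨z, hz, hz'⟩ := ih _ hcard (hA.subset hAA') hy₀r (fun a ha => hy' a (hAA' ha)) rfl
  have hp0 : ∀ a ∈ A', ⟪a, p'⟫_ℝ = 0 ∧ ⟪a, w p'⟫_ℝ = 0 ∧ ⟪a, w.symm p'⟫_ℝ = 0 := fun a ha =>
    ⟨hA'K a ha _ hpK', hA'K a ha _ (map_mem_symmEigenspace hpK'),
      hA'K a ha _ (symm_mem_symmEigenspace hpK')⟩
  have hfin : (A \ A').Finite := hA.subset Set.sdiff_subset
  have hnear : ∀ u, (∀ a ∈ A \ A', 0 < ⟪a, u⟫_ℝ * ⟪a, p'⟫_ℝ) → ArrRegular A' u →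
      ∀ᶠ ε : ℝ in 𝓝[>] 0, ArrReach w A u (p' + ε • u) := fun u hu hur => by
    filter_upwards [(eventually_add_smul_same_sign hfin hp' u).filter_mono nhdsWithin_le_nhds,
      self_mem_nhdsWithin] with ε h1 hε
    have hε : 0 < ε := hε
    refine ArrReach.of_same_chamber fun b hb => ?_
    by_cases hb' : b ∈ A'
    · rw [inner_add_right, inner_smul_right, (hp0 b hb').1, zero_add, mul_left_comm]
      exact mul_pos hε (mul_self_pos.2 (hur b hb'))
    · exact mul_pos_of_common (hu b ⟨hb, hb'⟩) (h1 b ⟨hb, hb'⟩)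
  obtain ⟨ε, h1, h2, h3, h4⟩ := ((hnear y₀ hy₀p' hy₀r).and
    ((hnear y' hyp' fun a ha => hy' a (hAA' ha)).and
      ((hz.eventually_add_smul hA hAA' hp' hp0).and
        (hz'.eventually_add_smul hA hAA' hp' hp0)))).exists
  exact ⟨p' + ε • z, hxy.trans (hyy₀.trans (h1.trans h3)), hxy'.trans (h2.trans h4)⟩

end Confluence

/-- A Euclidean representation of a Coxeter group in which the simple reflections act as the
orthogonal reflections in a basis `α`, satisfying the basic theorem on the positivity of roots. -/
structure CoxeterSystem.EuclideanRep {B W : Type*} [Group W] {M : CoxeterMatrix B}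
    (cs : CoxeterSystem M W) (V : Type*) [NormedAddCommGroup V] [InnerProductSpace ℝ V] where
  /-- The action of `W`. -/
  ρ : W →* (V ≃ₗᵢ[ℝ] V)
  /-- The simple roots. -/
  α : Module.Basis B ℝ V
  map_simple : ∀ i v, ρ (cs.simple i) v = v - (2 * ⟪α i, v⟫_ℝ / ⟪α i, α i⟫_ℝ) • α i
  inner_nonpos : ∀ i j, i ≠ j → ⟪α i, α j⟫_ℝ ≤ 0
  map_mem : ∀ u i, cs.length u < cs.length (u * cs.simple i) →
    ρ u (α i) ∈ Submodule.span ℝ≥0 (Set.range α)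

namespace CoxeterSystem.EuclideanRep
variable {B W : Type*} [Group W] {M : CoxeterMatrix B} {cs : CoxeterSystem M W}
  {V : Type*} [NormedAddCommGroup V] [InnerProductSpace ℝ V] (R : cs.EuclideanRep V)

theorem inner_nonneg_of_mem {v x : V} (hv : v ∈ Submodule.span ℝ≥0 (Set.range R.α))
    (hx : ∀ i, 0 ≤ ⟪R.α i, x⟫_ℝ) : 0 ≤ ⟪v, x⟫_ℝ := by
  induction hv using Submodule.span_induction with
  | mem v hv => obtain ⟨i, rfl⟩ := hv; exact hx i
  | zero => simp
  | add u v _ _ hu hv => rw [inner_add_left]; exact add_nonneg hu hv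
  | smul c v _ hv =>
    rw [NNReal.smul_def, inner_smul_left]
    exact mul_nonneg c.2 hv

theorem eq_zero_or_inner_pos_of_mem {v x : V} (hv : v ∈ Submodule.span ℝ≥0 (Set.range R.α))
    (hx : ∀ i, 0 < ⟪R.α i, x⟫_ℝ) : v = 0 ∨ 0 < ⟪v, x⟫_ℝ := by
  induction hv using Submodule.span_induction with
  | mem v hv => obtain ⟨i, rfl⟩ := hv; exact Or.inr (hx i)
  | zero => exact Or.inl rfl
  | add a b _ _ ha hb =>
    rcases ha with rfl | ha
    · simpa using hb
    · rcases hb with rfl | hb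
      · simpa using Or.inr ha
      · right; rw [inner_add_left]; exact add_pos ha hb
  | smul c a _ ha =>
    rcases ha with rfl | ha
    · simp
    · rcases eq_or_ne c 0 with rfl | hc
      · simp
      · right
        rw [NNReal.smul_def, inner_smul_left]
        exact mul_pos (NNReal.coe_pos.2 (pos_iff_ne_zero.2 hc)) ha

theorem map_mul_apply (u v : W) (x : V) : R.ρ (u * v) x = R.ρ u (R.ρ v x) := by
  rw [map_mul]; rfl

theorem inner_self_pos (i : B) : 0 < ⟪R.α i, R.α i⟫_ℝ :=
  real_inner_self_pos.2 (R.α.ne_zero i)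

theorem map_simple_self (i : B) : R.ρ (cs.simple i) (R.α i) = -R.α i := by
  rw [R.map_simple, mul_div_assoc, div_self (R.inner_self_pos i).ne']
  module

theorem neg_map_mem {u : W} {i : B} (h : cs.length (u * cs.simple i) < cs.length u) :
    -R.ρ u (R.α i) ∈ Submodule.span ℝ≥0 (Set.range R.α) := by
  have h1 := R.map_mem (u * cs.simple i) i (by simpa using h)
  rwa [map_mul_apply, R.map_simple_self, map_neg] at h1

theorem lt_of_inner_neg {u : W} {i : B} {x : V} (hx : ∀ j, 0 ≤ ⟪R.α j, x⟫_ℝ)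
    (h : ⟪R.ρ u (R.α i), x⟫_ℝ < 0) : cs.length (u * cs.simple i) < cs.length u := by
  by_contra hcon
  have h1 := cs.length_mul_simple_ne u i
  exact absurd (R.inner_nonneg_of_mem (R.map_mem u i (by omega)) hx) (not_le.2 h)

theorem inner_map_left (u : W) (a x : V) : ⟪R.ρ u a, x⟫_ℝ = ⟪a, R.ρ u⁻¹ x⟫_ℝ := by
  rw [(R.ρ u).inner_map_eq_flip, map_inv]; rfl

theorem map_inv_symm (u : W) (x : V) : (R.ρ u).symm x = R.ρ u⁻¹ x := by
  rw [map_inv]; rfl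

/-- The open chamber of `u`. -/
def InChamber (u : W) (x : V) : Prop := ∀ i, 0 < ⟪R.ρ u (R.α i), x⟫_ℝ

variable {R} in
theorem InChamber.pos {u : W} {x : V} (h : R.InChamber u x) (i : B) :
    0 ≤ ⟪R.α i, R.ρ u⁻¹ x⟫_ℝ := by
  rw [← inner_map_left]; exact (h i).le

variable {R} in
theorem InChamber.eq {u u' : W} {x : V} (h : R.InChamber u x) (h' : R.InChamber u' x) :
    u = u' := by
  by_contra hne
  have h1 : u'⁻¹ * u ≠ 1 := fun h => hne (by rw [inv_mul_eq_one] at h; exact h.symm)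
  obtain ⟨i, hi⟩ := cs.exists_rightDescent_of_ne_one h1
  have h2 := R.inner_nonneg_of_mem (R.neg_map_mem hi) h'.pos
  rw [inner_neg_left, ← inner_map_left, ← map_mul_apply,
    mul_inv_cancel_left] at h2
  linarith [h i]

/-- The set of roots. -/
def roots : Set V := Set.range fun p : W × B => R.ρ p.1 (R.α p.2)

theorem finite_roots [Finite W] [Finite B] : R.roots.Finite := Set.finite_range _

theorem exists_inChamber_one [Finite B] : ∃ x, R.InChamber 1 x := by
  have : FiniteDimensional ℝ V := R.α.finiteDimensional_of_finite
  let f : V →ₗ[ℝ] ℝ := R.α.constr ℝ fun _ => (1 : ℝ)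
  refine ⟨(InnerProductSpace.toDual ℝ V).symm f.toContinuousLinearMap, fun i => ?_⟩
  rw [real_inner_comm, InnerProductSpace.toDual_symm_apply]
  simp [f]

theorem InChamber.map {u : W} {x : V} (h : R.InChamber u x) (g : W) :
    R.InChamber (g * u) (R.ρ g x) := fun i => by
  rw [map_mul_apply, LinearIsometryEquiv.inner_map_map]
  exact h i

variable {R} in
theorem InChamber.arrRegular {u : W} {x : V} (h : R.InChamber u x) :
    ArrRegular R.roots x := by
  rintro _ ⟨⟨g, i⟩, rfl⟩
  have key : ∀ k : W, ∀ i, cs.length k < cs.length (k * cs.simple i) →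
      ⟪R.ρ (u * k) (R.α i), x⟫_ℝ ≠ 0 := by
    intro k i hk h0
    have hmem := R.map_mem k i hk
    have := R.eq_zero_or_inner_pos_of_mem hmem (x := R.ρ u⁻¹ x)
      fun j => by rw [← inner_map_left]; exact h j
    rcases this with h1 | h1
    · exact R.α.ne_zero i (by simpa using h1)
    · rw [map_mul_apply, inner_map_left] at h0
      exact h1.ne' h0
  have hg : g = u * (u⁻¹ * g) := by simp
  simp only
  rw [hg]
  rcases cs.length_mul_simple (u⁻¹ * g) i with h1 | h1
  · exact key _ i (by omega)
  · have := key (u⁻¹ * g * cs.simple i) i (by rw [cs.simple_mul_simple_cancel_right]; omega)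
    rwa [← mul_assoc, R.map_mul_apply _ (cs.simple i),
      R.map_simple_self, map_neg, inner_neg_left, neg_ne_zero] at this

/-- A step between chambers of the root arrangement is a cyclic shift. -/
theorem exists_cyclicShiftTo_of_arrStep {w u : W} {x y : V} (hx : R.InChamber u x)
    (h : ArrStep (R.ρ w) R.roots x y) :
    ∃ u', R.InChamber u' y ∧ cs.CyclicShiftTo (u⁻¹ * w * u) (u'⁻¹ * w * u') := by
  have hroot : ∀ g i, R.ρ g (R.α i) ∈ R.roots := fun g i => ⟨(g, i), rfl⟩
  rcases h with h | ⟨a, ha, hay, hpar, hdesc⟩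
  · exact ⟨u, fun i => pos_of_mul_pos_right (h _ (hroot u i)) (hx i).le, Relation.ReflTransGen.refl⟩
  by_cases hall : R.InChamber u y
  · exact ⟨u, hall, Relation.ReflTransGen.refl⟩
  simp only [InChamber, not_forall, not_lt] at hall
  obtain ⟨s, hs⟩ := hall
  obtain ⟨c, hc⟩ := (hpar _ (hroot u s)).resolve_right fun hpos => by
    nlinarith [hx s]
  have hc0 : c ≠ 0 := by
    rintro rfl
    have := hx s
    simp [hc] at this
  have hcc : 0 < c * c := mul_self_pos.2 hc0
  have hneg : ∀ z, ⟪a, x⟫_ℝ * ⟪a, z⟫_ℝ < 0 → ⟪R.ρ u (R.α s), z⟫_ℝ < 0 := fun z hz => by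
    have h1 := hx s
    rw [hc, inner_smul_left, conj_trivial] at h1 ⊢
    by_contra hcon
    push Not at hcon
    nlinarith [mul_nonneg h1.le hcon, mul_neg_of_pos_of_neg hcc hz]
  refine ⟨u * cs.simple s, fun r => ?_, ?_⟩
  · by_cases hrs : r = s
    · subst hrs
      rw [map_mul_apply, R.map_simple_self, map_neg, inner_neg_left]
      linarith [hneg y hay]
    · have hk : R.ρ (u * cs.simple s) (R.α r) = R.ρ u (R.α r) +
          (-(2 * ⟪R.α s, R.α r⟫_ℝ / ⟪R.α s, R.α s⟫_ℝ)) • R.ρ u (R.α s) := by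
        rw [map_mul_apply, R.map_simple, map_sub, map_smul]
        module
      have hk0 : 0 ≤ -(2 * ⟪R.α s, R.α r⟫_ℝ / ⟪R.α s, R.α s⟫_ℝ) := by
        rw [neg_nonneg]
        exact div_nonpos_of_nonpos_of_nonneg
          (by linarith [R.inner_nonpos s r (Ne.symm hrs)]) (R.inner_self_pos s).le
      have hbx : 0 < ⟪R.ρ (u * cs.simple s) (R.α r), x⟫_ℝ := by
        rw [hk, inner_add_left, inner_smul_left, conj_trivial]
        nlinarith [hx r, mul_nonneg hk0 (hx s).le]
      rcases hpar _ (hroot (u * cs.simple s) r) with ⟨c', hc'⟩ | hpos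
      · exfalso
        have ha' : a = c⁻¹ • R.ρ u (R.α s) := by rw [hc, inv_smul_smul₀ hc0]
        set k := -(2 * ⟪R.α s, R.α r⟫_ℝ / ⟪R.α s, R.α s⟫_ℝ)
        have h3 : R.ρ u (R.α r + k • R.α s) = R.ρ u ((c' * c⁻¹) • R.α s) := by
          rw [map_add, map_smul, map_smul, ← hk, hc', ha', smul_smul]
        have h4 := congrArg (fun v => R.α.repr v r) ((R.ρ u).injective h3)
        simp [Ne.symm hrs] at h4
      · exact pos_of_mul_pos_right hpos hbx.le
  · refine Relation.ReflTransGen.single ⟨s, by simp [mul_assoc], ?_⟩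
    have hgoal : (u * cs.simple s)⁻¹ * w * (u * cs.simple s) =
      cs.simple s * (u⁻¹ * w * u) * cs.simple s := by simp [mul_assoc]
    rw [hgoal]
    rcases hdesc with hd | hd
    · have h1 := hneg _ hd
      have h2 : ⟪R.ρ (u⁻¹ * w * u)⁻¹ (R.α s), R.ρ u⁻¹ x⟫_ℝ < 0 := by
        rw [← inner_map_left, ← map_mul_apply]
        rw [real_inner_comm, inner_map_left, real_inner_comm, ← map_mul_apply] at h1
        simpa [mul_assoc] using h1
      have h3 := R.lt_of_inner_neg hx.pos h2
      have h4 : cs.length (cs.simple s * (u⁻¹ * w * u)) < cs.length (u⁻¹ * w * u) := by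
        rw [← cs.length_inv (cs.simple s * _), ← cs.length_inv (u⁻¹ * w * u), mul_inv_rev,
          cs.inv_simple]
        exact h3
      rcases cs.length_mul_simple (cs.simple s * (u⁻¹ * w * u)) s with h5 | h5 <;> omega
    · have h1 := hneg _ hd
      have h2 : ⟪R.ρ (u⁻¹ * w * u) (R.α s), R.ρ u⁻¹ x⟫_ℝ < 0 := by
        rw [← inner_map_left, ← map_mul_apply]
        rw [map_inv_symm, real_inner_comm, inner_map_left, inv_inv, real_inner_comm,
          ← map_mul_apply] at h1
        simpa [mul_assoc] using h1
      have h3 := R.lt_of_inner_neg hx.pos h2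
      rw [mul_assoc]
      rcases cs.length_simple_mul (u⁻¹ * w * u * cs.simple s) s with h5 | h5 <;> omega

theorem exists_cyclicShiftTo_of_arrReach {w u : W} {x y : V} (hx : R.InChamber u x)
    (h : ArrReach (R.ρ w) R.roots x y) :
    ∃ u', R.InChamber u' y ∧ cs.CyclicShiftTo (u⁻¹ * w * u) (u'⁻¹ * w * u') := by
  induction h with
  | refl => exact ⟨u, hx, Relation.ReflTransGen.refl⟩
  | tail _ h ih =>
    obtain ⟨u₁, h1, h2⟩ := ih
    obtain ⟨u₂, h3, h4⟩ := R.exists_cyclicShiftTo_of_arrStep h1 h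
    exact ⟨u₂, h3, h2.trans h4⟩

theorem mem_parabolic_of_map_eq {v : V} (hv : ∀ i, 0 ≤ ⟪R.α i, v⟫_ℝ) {g : W}
    (hg : R.ρ g v = v) : g ∈ cs.parabolic {i | ⟪R.α i, v⟫_ℝ = 0} := by
  induction hn : cs.length g using Nat.strong_induction_on generalizing g with
  | _ n ih =>
  by_cases h1 : g = 1
  · rw [h1]; exact one_mem _
  obtain ⟨s, hs⟩ := cs.exists_rightDescent_of_ne_one h1
  have h2 := R.inner_nonneg_of_mem (R.neg_map_mem hs) hv
  have h2' : ⟪R.ρ g (R.α s), v⟫_ℝ = ⟪R.α s, v⟫_ℝ := by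
    rw [← (R.ρ g).inner_map_map (R.α s) v, hg]
  rw [inner_neg_left, h2'] at h2
  have h3 : ⟪R.α s, v⟫_ℝ = 0 := le_antisymm (by linarith) (hv s)
  have h4 : R.ρ (cs.simple s) v = v := by rw [R.map_simple, h3]; simp
  have h5 := ih _ (hn ▸ hs) (g := g * cs.simple s)
    (by rw [map_mul_apply, h4, hg]) rfl
  have h6 : g = g * cs.simple s * cs.simple s := by simp
  rw [h6]
  exact mul_mem h5 (Subgroup.subset_closure ⟨s, h3, rfl⟩)

theorem exists_map_nonneg [Finite W] [Finite B] (v : V) :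
    ∃ u : W, ∀ i, 0 ≤ ⟪R.α i, R.ρ u v⟫_ℝ := by
  obtain ⟨x, hx⟩ := R.exists_inChamber_one
  obtain ⟨u, hu⟩ := Finite.exists_max fun u : W => ⟪R.ρ u x, v⟫_ℝ
  refine ⟨u⁻¹, fun i => ?_⟩
  have h1 := hu (u * cs.simple i)
  have hxi : 0 < ⟪R.α i, x⟫_ℝ := by simpa using hx i
  rw [map_mul_apply, R.map_simple, map_sub, map_smul, inner_sub_left,
    inner_smul_left, conj_trivial, R.inner_map_left u (R.α i)] at h1
  have h2 : 0 < 2 * ⟪R.α i, x⟫_ℝ / ⟪R.α i, R.α i⟫_ℝ :=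
    div_pos (by linarith) (R.inner_self_pos i)
  exact nonneg_of_mul_nonneg_right (by linarith) h2

/-- Elements of cuspidal classes have no nonzero fixed vector. -/
theorem eq_zero_of_map_eq [Finite W] [Finite B] {w : W}
    (hw : ∀ I : Set B, I ⊂ Set.univ → ∀ g, IsConj w g → g ∉ cs.parabolic I)
    {v : V} (hv : R.ρ w v = v) : v = 0 := by
  obtain ⟨u, hu⟩ := R.exists_map_nonneg v
  have h1 : R.ρ (u * w * u⁻¹) (R.ρ u v) = R.ρ u v := by
    rw [← map_mul_apply, inv_mul_cancel_right, map_mul_apply, hv]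
  have h2 := R.mem_parabolic_of_map_eq hu h1
  by_contra hne
  refine hw _ ?_ _ (isConj_iff.2 ⟨u, rfl⟩) h2
  refine Set.ssubset_univ_iff.2 fun h => hne ?_
  have h3 : ∀ i, ⟪R.α i, R.ρ u v⟫_ℝ = 0 := fun i => by
    have : i ∈ {i | ⟪R.α i, R.ρ u v⟫_ℝ = 0} := h ▸ Set.mem_univ i
    exact this
  have h4 : R.ρ u v = 0 := by
    have h5 : (innerₗ V (R.ρ u v)) = 0 :=
      R.α.ext fun i => by simpa [real_inner_comm] using h3 i
    exact inner_self_eq_zero.1 (LinearMap.congr_fun h5 (R.ρ u v))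
  simpa using h4

/-- Any two conjugates of an element of a cuspidal class have a common cyclic shift. -/
theorem exists_cyclicShiftTo_common (R : cs.EuclideanRep V) [Finite W] [Finite B] {w w' : W}
    (hw : ∀ I : Set B, I ⊂ Set.univ → ∀ g, IsConj w g → g ∉ cs.parabolic I) (h : IsConj w w') :
    ∃ d, cs.CyclicShiftTo w d ∧ cs.CyclicShiftTo w' d := by
  have : FiniteDimensional ℝ V := R.α.finiteDimensional_of_finite
  obtain ⟨g, rfl⟩ := isConj_iff.1 h
  obtain ⟨x, hx⟩ := R.exists_inChamber_one
  have hx' := InChamber.map R hx g⁻¹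
  obtain ⟨z, hz, hz'⟩ := exists_arrReach_common (w := R.ρ w) (fun v => R.eq_zero_of_map_eq hw)
    R.finite_roots hx.arrRegular hx'.arrRegular
  obtain ⟨u, hu, h1⟩ := R.exists_cyclicShiftTo_of_arrReach hx hz
  obtain ⟨u', hu', h2⟩ := R.exists_cyclicShiftTo_of_arrReach hx' hz'
  obtain rfl := hu.eq hu'
  exact ⟨_, by simpa using h1, by simpa using h2⟩

end CoxeterSystem.EuclideanRep

theorem reflection_mul_reflection_pow_eq_one {E : Type*} [AddCommGroup E] [Module ℝ E] {x y : E}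
    {f g : Module.Dual ℝ E} (hf : f x = 2) (hg : g y = 2) {m : ℕ} (hm : m ≠ 1)
    (hfy : f y = -(2 * Real.cos (Real.pi / m))) (hgx : g x = -(2 * Real.cos (Real.pi / m))) :
    (Module.reflection hf * Module.reflection hg) ^ m = 1 := by
  ext z
  rcases Nat.lt_or_ge m 3 with h3 | h3
  · interval_cases m
    · simp
    · exact absurd rfl hm
    · simp only [Nat.cast_ofNat, Real.cos_pi_div_two, mul_zero, neg_zero] at hfy hgx
      simp [pow_two, Module.reflection_apply, hf, hg, hfy, hgx]
      module
  · set φ := 2 * (Real.pi / m) with hφ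
    have hm0 : (0 : ℝ) < m := by positivity
    have hmφ : m * φ = 2 * Real.pi := by rw [hφ]; field_simp
    have ht : 2 * Real.cos φ = f y * g x - 2 := by
      rw [hfy, hgx, hφ, Real.cos_two_mul]; ring
    have hsin : Real.sin φ ≠ 0 := by
      refine (Real.sin_pos_of_pos_of_lt_pi (by positivity) ?_).ne'
      have : (3 : ℝ) ≤ m := by exact_mod_cast h3
      nlinarith [Real.pi_pos]
    rw [Module.reflection_mul_reflection_pow_apply hf hg m z _ ht]
    rcases Nat.even_or_odd' m with ⟨k, rfl | rfl⟩
    · have e1 : (((2 * k : ℕ) : ℤ) - 2) / 2 = (k : ℤ) - 1 := by omega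
      have e2 : (((2 * k : ℕ) : ℤ) - 1) / 2 = (k : ℤ) - 1 := by omega
      have hS : Polynomial.eval (2 * Real.cos φ) (Polynomial.Chebyshev.S ℝ ((k : ℤ) - 1)) = 0 := by
        have h1 := Polynomial.Chebyshev.S_two_mul_real_cos φ ((k : ℤ) - 1)
        have h2 : (((k : ℤ) - 1 : ℤ) + 1 : ℝ) * φ = Real.pi := by
          push_cast at hmφ ⊢; linarith
        rw [h2, Real.sin_pi] at h1
        exact (mul_eq_zero.1 h1).resolve_right hsin
      rw [e1, e2, hS]
      simp
    · have e1 : (((2 * k + 1 : ℕ) : ℤ) - 2) / 2 = (k : ℤ) - 1 := by omega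
      have e2 : (((2 * k + 1 : ℕ) : ℤ) - 1) / 2 = k := by omega
      have e3 : (((2 * k + 1 : ℕ) : ℤ) - 3) / 2 = (k : ℤ) - 1 := by omega
      have e4 : ((2 * k + 1 : ℕ) : ℤ) / 2 = k := by omega
      have hS : Polynomial.eval (2 * Real.cos φ) (Polynomial.Chebyshev.S ℝ (k : ℤ)) +
          Polynomial.eval (2 * Real.cos φ) (Polynomial.Chebyshev.S ℝ ((k : ℤ) - 1)) = 0 := by
        have h1 := Polynomial.Chebyshev.S_two_mul_real_cos φ ((k : ℤ) - 1)
        have h2 := Polynomial.Chebyshev.S_two_mul_real_cos φ k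
        have h3 : (((k : ℤ) - 1 : ℤ) + 1 : ℝ) * φ = k * φ := by push_cast; ring
        have h4 : (((k : ℤ) : ℝ) + 1) * φ = 2 * Real.pi - k * φ := by
          push_cast at hmφ ⊢; linarith
        rw [h3] at h1
        rw [h4, Real.sin_two_pi_sub] at h2
        exact (mul_eq_zero.1 (show _ * Real.sin φ = 0 by rw [add_mul, h1, h2]; ring)).resolve_right
          hsin
      rw [e1, e2, e3, e4, hS]
      simp

namespace CoxeterMatrix
variable {B : Type*} (M : CoxeterMatrix B)

/-- Twice the entries of the cosine matrix. -/
noncomputable def cosEntry (i j : B) : ℝ := -(2 * Real.cos (Real.pi / M i j))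

theorem cosEntry_self (i : B) : M.cosEntry i i = 2 := by simp [cosEntry]

theorem cosEntry_nonpos {i j : B} (h : i ≠ j) : M.cosEntry i j ≤ 0 := by
  rw [cosEntry, neg_nonpos]
  refine mul_nonneg zero_le_two (Real.cos_nonneg_of_mem_Icc ⟨?_, ?_⟩)
  · exact (neg_nonpos.2 (by positivity)).trans (by positivity)
  · rcases Nat.eq_zero_or_pos (M i j) with h0 | h0
    · rw [h0]; simp; positivity
    · have h1 : 2 ≤ M i j := by have := M.off_diagonal i j h; omega
      have h2 : (2 : ℝ) ≤ M i j := by exact_mod_cast h1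
      gcongr

/-- The simple coroots. -/
noncomputable def coroot (i : B) : Module.Dual ℝ (B →₀ ℝ) :=
  Finsupp.linearCombination ℝ (M.cosEntry i)

theorem coroot_single (i j : B) : M.coroot i (Finsupp.single j 1) = M.cosEntry i j := by
  simp [coroot]

theorem coroot_self (i : B) : M.coroot i (Finsupp.single i 1) = 2 := by
  rw [coroot_single, cosEntry_self]

theorem isLiftable_reflection :
    M.IsLiftable fun i => Module.reflection (M.coroot_self i) := by
  intro i j
  by_cases h : i = j
  · subst h
    rw [M.diagonal, pow_one]
    ext1 z
    exact Module.involutive_reflection (M.coroot_self i) z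
  · refine reflection_mul_reflection_pow_eq_one _ _ (M.off_diagonal i j h) ?_ ?_
    · rw [coroot_single, cosEntry]
    · rw [coroot_single, cosEntry, M.symmetric]

end CoxeterMatrix

namespace CoxeterSystem
variable {B W : Type*} [Group W] {M : CoxeterMatrix B} (cs : CoxeterSystem M W)

/-- The geometric representation. -/
noncomputable def geomRep : W →* ((B →₀ ℝ) ≃ₗ[ℝ] (B →₀ ℝ)) :=
  cs.lift ⟨_, M.isLiftable_reflection⟩

theorem geomRep_simple (i : B) (v : B →₀ ℝ) :
    cs.geomRep (cs.simple i) v = v - M.coroot i v • Finsupp.single i 1 := by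
  rw [geomRep, lift_apply_simple, Module.reflection_apply]

theorem geomRep_mul (u v : W) (x : B →₀ ℝ) :
    cs.geomRep (u * v) x = cs.geomRep u (cs.geomRep v x) := by
  rw [map_mul]; rfl

theorem geomRep_simple_single_self (i : B) :
    cs.geomRep (cs.simple i) (Finsupp.single i 1) = -Finsupp.single i 1 := by
  rw [geomRep_simple, M.coroot_self]; module

theorem geomRep_simple_single (i j : B) : cs.geomRep (cs.simple i) (Finsupp.single j 1) =
    Finsupp.single j 1 + (2 * Real.cos (Real.pi / M i j)) • Finsupp.single i 1 := by
  rw [geomRep_simple, M.coroot_single, CoxeterMatrix.cosEntry]; module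

theorem simple_injective : Function.Injective cs.simple := by
  classical
  intro i j h
  by_contra hne
  have h1 := cs.geomRep_simple_single_self i
  rw [h, geomRep_simple_single] at h1
  have h2 := DFunLike.congr_fun h1 i
  simp [Ne.symm hne] at h2
  norm_num at h2

end CoxeterSystem

/-- The coefficients `sin (k θ) / sin θ` as polynomials in `c = cos θ`. -/
def dihedralCoeff (c : ℝ) : ℕ → ℝ
  | 0 => 0
  | 1 => 1
  | k + 2 => 2 * c * dihedralCoeff c (k + 1) - dihedralCoeff c k

theorem dihedralCoeff_cos_mul_sin (θ : ℝ) (k : ℕ) :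
    dihedralCoeff (Real.cos θ) k * Real.sin θ = Real.sin (k * θ) := by
  induction k using Nat.twoStepInduction with
  | zero => simp [dihedralCoeff]
  | one => simp [dihedralCoeff]
  | more k h1 h2 =>
    rw [dihedralCoeff, sub_mul, mul_assoc, h1, h2]
    have e1 : ((k + 2 : ℕ) : ℝ) * θ = (k + 1 : ℕ) * θ + θ := by push_cast; ring
    have e2 : (k : ℝ) * θ = (k + 1 : ℕ) * θ - θ := by push_cast; ring
    rw [e1, e2, Real.sin_add, Real.sin_sub]
    ring

theorem dihedralCoeff_one_eq (k : ℕ) : dihedralCoeff 1 k = k := by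
  induction k using Nat.twoStepInduction with
  | zero => simp [dihedralCoeff]
  | one => simp [dihedralCoeff]
  | more k h1 h2 => rw [dihedralCoeff, h1, h2]; push_cast; ring

theorem dihedralCoeff_nonneg {m k : ℕ} (h : m = 0 ∨ k ≤ m) :
    0 ≤ dihedralCoeff (Real.cos (Real.pi / m)) k := by
  rcases Nat.lt_or_ge m 2 with h2 | h2
  · rcases Nat.eq_zero_or_pos m with rfl | h3
    · simp [dihedralCoeff_one_eq]
    · have : k ≤ 1 := by omega
      interval_cases k <;> simp [dihedralCoeff]
  · have hm : (2 : ℝ) ≤ m := by exact_mod_cast h2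
    have hk : (k : ℝ) ≤ m := by exact_mod_cast h.resolve_left (by omega)
    have hpi := Real.pi_pos
    have hsin : 0 < Real.sin (Real.pi / m) := by
      refine Real.sin_pos_of_pos_of_lt_pi (by positivity) (div_lt_self hpi (by linarith))
    refine nonneg_of_mul_nonneg_left ?_ hsin
    rw [dihedralCoeff_cos_mul_sin]
    refine Real.sin_nonneg_of_nonneg_of_le_pi (by positivity) ?_
    rw [mul_div_assoc', div_le_iff₀ (by linarith), mul_comm]
    gcongr

namespace CoxeterSystem
variable {B W : Type*} [Group W] {M : CoxeterMatrix B} (cs : CoxeterSystem M W)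

theorem geomRep_alternatingWord (s t : B) (k : ℕ) :
    cs.geomRep (cs.wordProd (alternatingWord s t k)) (Finsupp.single s 1) =
      if Even k then
        dihedralCoeff (Real.cos (Real.pi / M s t)) (k + 1) • Finsupp.single s 1 +
          dihedralCoeff (Real.cos (Real.pi / M s t)) k • Finsupp.single t 1
      else
        dihedralCoeff (Real.cos (Real.pi / M s t)) k • Finsupp.single s 1 +
          dihedralCoeff (Real.cos (Real.pi / M s t)) (k + 1) • Finsupp.single t 1 := by
  induction k with
  | zero => simp [alternatingWord, dihedralCoeff]
  | succ k ih =>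
    rw [alternatingWord_succ', wordProd_cons, geomRep_mul, ih]
    by_cases hk : Even k
    · have hk' : ¬ Even (k + 1) := by simpa [Nat.even_add_one] using hk
      simp only [hk, hk', if_true, if_false]
      rw [map_add, map_smul, map_smul, geomRep_simple_single_self, geomRep_simple_single,
        M.symmetric t s, dihedralCoeff]
      module
    · have hk' : Even (k + 1) := by simpa [Nat.even_add_one] using hk
      simp only [hk, hk', if_true, if_false]
      rw [map_add, map_smul, map_smul, geomRep_simple_single_self, geomRep_simple_single,
        dihedralCoeff]
      module

/-- If `t` is a descent of `w` and `s` is not, then `w` is the product with lengths adding of an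
element without descents `s` and `t` and an alternating word. -/
theorem exists_eq_mul_alternatingWord {w : W} {s t : B} (hs : cs.length w < cs.length (w * cs.simple s))
    (ht : cs.IsRightDescent w t) :
    ∃ u k, w = u * cs.wordProd (alternatingWord s t k) ∧ cs.length u < cs.length w ∧
      cs.length u < cs.length (u * cs.simple s) ∧ cs.length u < cs.length (u * cs.simple t) ∧
      (M s t = 0 ∨ k + 1 ≤ M s t) := by
  classical
  let v : ℕ → W := fun k => cs.wordProd (alternatingWord s t k)
  have hv : ∀ k, v (k + 1) = cs.simple (if Even k then t else s) * v k := fun k => by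
    simp only [v]; rw [alternatingWord_succ', wordProd_cons]
  have hlv : ∀ k, cs.length (v k) ≤ k := fun k =>
    (cs.length_wordProd_le _).trans (length_alternatingWord s t k).le
  let P : ℕ → Prop := fun k => cs.length (w * (v k)⁻¹) + k = cs.length w
  have hP1 : P 1 := by
    have h1 := cs.isRightDescent_iff.1 ht
    simpa [P, v, alternatingWord] using h1
  have hw : 1 ≤ cs.length w := by simp only [P] at hP1; omega
  set K := Nat.findGreatest P (cs.length w) with hK
  have hPK : P K := Nat.findGreatest_spec hw hP1
  have hK1 : 1 ≤ K := Nat.le_findGreatest hw hP1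
  have hmax : ¬ P (K + 1) := fun h => by
    have h1 : K + 1 ≤ cs.length w := by simp only [P] at h; omega
    exact absurd (Nat.le_findGreatest h1 h) (by omega)
  set u := w * (v K)⁻¹ with hu
  have hwu : w = u * v K := by simp [hu]
  have hPK' : cs.length u + K = cs.length w := hPK
  have hr : cs.length u < cs.length (u * cs.simple (if Even K then t else s)) := by
    rcases cs.length_mul_simple u (if Even K then t else s) with h | h
    · omega
    · refine absurd ?_ hmax
      have : w * (v (K + 1))⁻¹ = u * cs.simple (if Even K then t else s) := by
        rw [hv, mul_inv_rev, inv_simple, hu, mul_assoc]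
      simp only [P]
      rw [this]; omega
  have hq : cs.length u < cs.length (u * cs.simple (if Even (K - 1) then t else s)) := by
    have h1 : w = u * cs.simple (if Even (K - 1) then t else s) * v (K - 1) := by
      rw [mul_assoc, ← hv, Nat.sub_add_cancel hK1, ← hwu]
    have h2 := cs.length_mul_le (u * cs.simple (if Even (K - 1) then t else s)) (v (K - 1))
    rw [← h1] at h2
    have h3 := hlv (K - 1)
    omega
  have hpar : Even (K - 1) ↔ ¬ Even K := by
    conv_rhs => rw [← Nat.sub_add_cancel hK1]
    rw [Nat.even_add_one, not_not]
  refine ⟨u, K, hwu, by omega, ?_, ?_, ?_⟩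
  · by_cases h : Even K
    · simpa [hpar, h] using hq
    · simpa [h] using hr
  · by_cases h : Even K
    · simpa [h] using hr
    · simpa [hpar, h] using hq
  · by_contra! hcon
    obtain ⟨hM, hKM⟩ := hcon
    have hle := cs.length_mul_le u (v K)
    rw [← hwu] at hle
    rcases (Nat.lt_succ_iff.1 hKM).lt_or_eq with h | h
    · refine cs.not_isReduced_alternatingWord s t hM h ?_
      have := hlv K
      rw [IsReduced, length_alternatingWord]
      change cs.length (v K) = K
      omega
    · have h1 : v K = cs.wordProd (alternatingWord s t (K - 1)) * cs.simple s := by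
        have h2 : v K = cs.wordProd (alternatingWord t s (K - 1 + 1)) := by
          rw [Nat.sub_add_cancel hK1]
          have := cs.wordProd_braidWord_eq s t
          rwa [braidWord, braidWord, M.symmetric t s, h] at this
        rw [h2, alternatingWord_succ, wordProd_concat]
      have h2 : w * cs.simple s = u * v (K - 1) := by
        rw [hwu, h1]; simp [mul_assoc, v]
      have h3 := cs.length_mul_le u (v (K - 1))
      rw [← h2] at h3
      have := hlv (K - 1)
      omega

theorem geomRep_single_nonneg (w : W) (s : B) (h : cs.length w < cs.length (w * cs.simple s)) :
    0 ≤ cs.geomRep w (Finsupp.single s 1) := by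
  induction hn : cs.length w using Nat.strong_induction_on generalizing w s with
  | _ n ih =>
  by_cases h1 : w = 1
  · subst h1; simp
  obtain ⟨t, ht⟩ := cs.exists_rightDescent_of_ne_one h1
  obtain ⟨u, k, rfl, hlt, hus, hut, hk⟩ := cs.exists_eq_mul_alternatingWord h ht
  have hs' := ih _ (hn ▸ hlt) u s hus rfl
  have ht' := ih _ (hn ▸ hlt) u t hut rfl
  have hc1 := dihedralCoeff_nonneg hk
  have hc0 := dihedralCoeff_nonneg (hk.imp_right fun h => (Nat.le_succ k).trans h)
  rw [geomRep_mul, geomRep_alternatingWord]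
  split_ifs
  all_goals
    rw [map_add, map_smul, map_smul]
    positivity

end CoxeterSystem

theorem LinearIsometryEquiv.eq_inner_div_of_map_eq {V : Type*} [NormedAddCommGroup V]
    [InnerProductSpace ℝ V] (g : V ≃ₗᵢ[ℝ] V) {a x : V} {c : ℝ} (ha : g a = -a)
    (hx : g x = x - c • a) (ha0 : a ≠ 0) : c = 2 * ⟪a, x⟫_ℝ / ⟪a, a⟫_ℝ := by
  have h1 := g.inner_map_map a x
  rw [ha, hx, inner_neg_left, inner_sub_right, real_inner_smul_right] at h1
  rw [eq_div_iff (inner_self_ne_zero.2 ha0)]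
  linarith

namespace CoxeterSystem
variable {B W : Type*} [Group W] {M : CoxeterMatrix B} (cs : CoxeterSystem M W)

/-- The coordinates of all translates of a vector of the geometric representation. The Euclidean
norm of the resulting family is invariant under the group. -/
noncomputable def orbitMap : (B →₀ ℝ) →ₗ[ℝ] EuclideanSpace ℝ (W × B) :=
  (WithLp.linearEquiv 2 ℝ (W × B → ℝ)).symm.toLinearMap ∘ₗ
    LinearMap.pi fun p => Finsupp.lapply p.2 ∘ₗ (cs.geomRep p.1).toLinearMap

theorem orbitMap_apply (v : B →₀ ℝ) (p : W × B) : cs.orbitMap v p = cs.geomRep p.1 v p.2 := rfl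

theorem orbitMap_injective : Function.Injective cs.orbitMap := fun x y h => by
  ext i
  have h1 : cs.orbitMap x (1, i) = cs.orbitMap y (1, i) := by rw [h]
  simpa [orbitMap_apply] using h1

theorem norm_orbitMap_geomRep [Fintype W] [Fintype B] (g : W) (v : B →₀ ℝ) :
    ‖cs.orbitMap (cs.geomRep g v)‖ = ‖cs.orbitMap v‖ := by
  rw [EuclideanSpace.norm_eq, EuclideanSpace.norm_eq]
  congr 1
  simp only [orbitMap_apply, ← geomRep_mul]
  rw [Fintype.sum_prod_type, Fintype.sum_prod_type]
  exact Equiv.sum_comp (Equiv.mulRight g) fun h => ∑ i, ‖cs.geomRep h v i‖ ^ 2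

/-- The geometric representation as a space of translates. -/
noncomputable def orbitEquiv : (B →₀ ℝ) ≃ₗ[ℝ] LinearMap.range cs.orbitMap :=
  LinearEquiv.ofInjective _ cs.orbitMap_injective

/-- The geometric representation of a finite Coxeter group, by isometries. -/
noncomputable def isometryRep [Fintype W] [Fintype B] :
    W →* (LinearMap.range cs.orbitMap ≃ₗᵢ[ℝ] LinearMap.range cs.orbitMap) where
  toFun g :=
    { toLinearEquiv := cs.orbitEquiv.symm ≪≫ₗ cs.geomRep g ≪≫ₗ cs.orbitEquiv
      norm_map' := fun x => by
        obtain ⟨v, rfl⟩ := cs.orbitEquiv.surjective x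
        change ‖cs.orbitEquiv (cs.geomRep g (cs.orbitEquiv.symm (cs.orbitEquiv v)))‖ = _
        rw [LinearEquiv.symm_apply_apply]
        exact cs.norm_orbitMap_geomRep g v }
  map_one' := by ext1 x; simp
  map_mul' g h := by
    ext1 x
    change cs.orbitEquiv (cs.geomRep (g * h) (cs.orbitEquiv.symm x)) = cs.orbitEquiv
      (cs.geomRep g (cs.orbitEquiv.symm (cs.orbitEquiv (cs.geomRep h (cs.orbitEquiv.symm x)))))
    rw [LinearEquiv.symm_apply_apply, geomRep_mul]

theorem isometryRep_orbitEquiv [Fintype W] [Fintype B] (g : W) (v : B →₀ ℝ) :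
    cs.isometryRep g (cs.orbitEquiv v) = cs.orbitEquiv (cs.geomRep g v) := by
  change cs.orbitEquiv (cs.geomRep g (cs.orbitEquiv.symm (cs.orbitEquiv v))) = _
  rw [LinearEquiv.symm_apply_apply]

theorem coroot_eq_inner_div [Fintype W] [Fintype B] (i : B) (v : B →₀ ℝ) :
    M.coroot i v = 2 * ⟪cs.orbitEquiv (Finsupp.single i 1), cs.orbitEquiv v⟫_ℝ /
      ⟪cs.orbitEquiv (Finsupp.single i 1), cs.orbitEquiv (Finsupp.single i 1)⟫_ℝ := by
  refine LinearIsometryEquiv.eq_inner_div_of_map_eq (cs.isometryRep (cs.simple i)) ?_ ?_ ?_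
  · rw [isometryRep_orbitEquiv, geomRep_simple_single_self, map_neg]
  · rw [isometryRep_orbitEquiv, geomRep_simple, map_sub, map_smul]
  · rw [ne_eq, LinearEquiv.map_eq_zero_iff]
    simp

/-- The Euclidean representation of a finite Coxeter group. -/
noncomputable def euclideanRep [Fintype W] [Fintype B] :
    cs.EuclideanRep (LinearMap.range cs.orbitMap) where
  ρ := cs.isometryRep
  α := Finsupp.basisSingleOne.map cs.orbitEquiv
  map_simple i x := by
    obtain ⟨v, rfl⟩ := cs.orbitEquiv.surjective x
    rw [isometryRep_orbitEquiv, geomRep_simple, map_sub, map_smul, cs.coroot_eq_inner_div]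
    simp
  inner_nonpos i j hij := by
    have h1 := cs.coroot_eq_inner_div i (Finsupp.single j 1)
    rw [M.coroot_single] at h1
    have h2 := M.cosEntry_nonpos hij
    rw [h1] at h2
    by_contra! hcon
    simp only [Module.Basis.map_apply, Finsupp.coe_basisSingleOne] at hcon
    have h3 : 0 < ⟪cs.orbitEquiv (Finsupp.single i 1), cs.orbitEquiv (Finsupp.single i 1)⟫_ℝ := by
      rw [real_inner_self_pos, ne_eq, LinearEquiv.map_eq_zero_iff]
      simp
    exact absurd h2 (not_le.2 (by positivity))
  map_mem u i h := by
    simp only [Module.Basis.map_apply, Finsupp.coe_basisSingleOne]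
    rw [isometryRep_orbitEquiv]
    have h1 := cs.geomRep_single_nonneg u i h
    set v := cs.geomRep u (Finsupp.single i 1)
    have h2 : v = ∑ j, v j • Finsupp.single j (1 : ℝ) := by
      ext k
      simp
    rw [h2, map_sum]
    refine Submodule.sum_mem _ fun j _ => ?_
    rw [map_smul]
    exact Submodule.smul_mem _ (⟨v j, h1 j⟩ : ℝ≥0) (Submodule.subset_span ⟨j, by simp⟩)

theorem IsConj.of_cyclicShiftTo {a b : W} (h : cs.CyclicShiftTo a b) : IsConj a b := by
  induction h with
  | refl => exact IsConj.refl _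
  | tail _ h ih =>
    obtain ⟨i, rfl, -⟩ := h
    exact ih.trans (isConj_iff.2 ⟨cs.simple i, by rw [cs.inv_simple]⟩)

theorem CyclicShiftTo.length_le {a b : W} (h : cs.CyclicShiftTo a b) :
    cs.length b ≤ cs.length a := by
  induction h with
  | refl => rfl
  | tail _ h ih => exact h.choose_spec.2.trans ih

theorem CyclicShiftTo.symm_of_length_le {a b : W} (h : cs.CyclicShiftTo a b)
    (hl : cs.length a ≤ cs.length b) : cs.CyclicShiftTo b a := by
  induction h with
  | refl => exact Relation.ReflTransGen.refl
  | tail h1 h2 ih =>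
    obtain ⟨i, rfl, h3⟩ := h2
    have h4 := CyclicShiftTo.length_le cs h1
    refine (Relation.ReflTransGen.single ⟨i, ?_, h4.trans hl⟩).trans (ih (hl.trans h3))
    simp [mul_assoc]

end CoxeterSystem

/-- Let `C` be a cuspidal conjugacy class of a finite Coxeter group `W`
(i.e. `C ∩ W_I = ∅` for every proper subset `I ⊊ S`).  Then the elements of `C_min` form a
single cyclic shift class: any two elements `w, w' ∈ C_min` satisfy `w ↔ w'`, and every element
of `W` that is `↔`-equivalent to an element of `C_min` lies in `C_min`. -/
theorem cuspidal_Cmin_single_cyclicShiftClass {B W : Type*} [Group W] [Finite W]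
    {M : CoxeterMatrix B} (cs : CoxeterSystem M W) (C : Set W) (hC : IsConjClassSet C)
    (hcusp : ∀ I : Set B, I ⊂ Set.univ → ∀ w ∈ C, w ∉ cs.parabolic I) :
    (∀ w ∈ cs.Cmin C, ∀ w' ∈ cs.Cmin C, cs.CyclicShiftEquiv w w') ∧
    (∀ w ∈ cs.Cmin C, ∀ y : W, cs.CyclicShiftEquiv y w → y ∈ cs.Cmin C) := by
  obtain ⟨w₀, rfl⟩ := hC
  have : Finite B := Finite.of_injective _ cs.simple_injective
  have := Fintype.ofFinite B
  have := Fintype.ofFinite W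
  have key : ∀ w ∈ cs.Cmin {x | IsConj w₀ x}, ∀ w' ∈ cs.Cmin {x | IsConj w₀ x},
      cs.CyclicShiftTo w w' := by
    rintro w ⟨hw, -⟩ w' ⟨hw', hmin⟩
    obtain ⟨d, h1, h2⟩ := cs.euclideanRep.exists_cyclicShiftTo_common (w := w) (w' := w')
      (fun I hI g hg => hcusp I hI g (IsConj.trans hw hg)) (IsConj.trans (IsConj.symm hw) hw')
    exact h1.trans (CoxeterSystem.CyclicShiftTo.symm_of_length_le cs h2
      (hmin d (IsConj.trans hw' (CoxeterSystem.IsConj.of_cyclicShiftTo cs h2))))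
  refine ⟨fun w hw w' hw' => ⟨key w hw w' hw', key w' hw' w hw⟩, fun w hw y hy => ⟨?_, fun x hx => ?_⟩⟩
  · exact IsConj.trans hw.1 (CoxeterSystem.IsConj.of_cyclicShiftTo cs hy.2)
  · exact (CoxeterSystem.CyclicShiftTo.length_le cs hy.2).trans (hw.2 x hx)
end

section
/- Let (W,S) be a Coxeter system of type B_n and let α be a partition of n with nonzero parts α₁ ≤ α₂ ≤ … ≤ α_h. Set m_i = α₁ + ⋯ + α_{i−1} (so m₁ = 0) and w_α = b⁻(m₁,α₁) b⁻(m₂,α₂) ⋯ b⁻(m_h,α_h). Then w_α = t₁ t₂ ⋯ t_n where t₁ = ŝ₀ = t and t_i ∈ {s_{i−1}, ŝ_{i−1}} for i ≥ 2, each t_i is a reflection, and ℓ(w_α) = ℓ(t₁) + ⋯ + ℓ(t_n); moreover, setting J_i := {t, s₁, …, s_{i−1}} for 1 ≤ i ≤ n and J₀ := ∅, one has t_i ∈ W_{J_i} and ℓ(s·t_i) > ℓ(t_i) for all s ∈ J_{i−1} and all 1 ≤ i ≤ n. -/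
/-- The simple reflection with natural-number index `k` (junk value `1` if `k ≥ n`).
In type `Bₙ` we label the generators so that index `0` is `t` and index `k` (`1 ≤ k ≤ n−1`)
is `s_k`. -/
def CoxeterSystem.gen {n : ℕ} {W : Type*} [Group W] {M : CoxeterMatrix (Fin n)}
    (cs : CoxeterSystem M W) (k : ℕ) : W :=
  if h : k < n then cs.simple ⟨k, h⟩ else 1

/-- The element `ŝ_i = s_i s_{i−1} ⋯ s₁ t s₁ ⋯ s_{i−1} s_i` of a Coxeter group of type `Bₙ`
(so `ŝ₀ = t`). -/
def CoxeterSystem.shatB {n : ℕ} {W : Type*} [Group W] {M : CoxeterMatrix (Fin n)}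
    (cs : CoxeterSystem M W) : ℕ → W
  | 0 => cs.gen 0
  | i + 1 => cs.gen (i + 1) * cs.shatB i * cs.gen (i + 1)

/-- The "negative block" `b⁻(m,d) = ŝ_m s_{m+1} s_{m+2} ⋯ s_{m+d−1}` of length `d`
starting at `m`, in type `Bₙ`. -/
def CoxeterSystem.negBlockB {n : ℕ} {W : Type*} [Group W] {M : CoxeterMatrix (Fin n)}
    (cs : CoxeterSystem M W) (m d : ℕ) : W :=
  cs.shatB m * ((List.range (d - 1)).map fun k => cs.gen (m + 1 + k)).prod

/-- `m_i = α₁ + ⋯ + α_{i−1}` (so `m₁ = 0`), for a sequence of parts `α` indexed by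
`1, …, h`. -/
def partSum (α : ℕ → ℕ) (i : ℕ) : ℕ := ∑ j ∈ Finset.Ico 1 i, α j

namespace SignedPerm

/-- The action of the `k`-th generator of type `B` on integer sequences: generator `0` negates
the entry at position `0`, and generator `k + 1` swaps the entries at positions `k` and `k + 1`. -/
def act : ℕ → Function.End (ℕ → ℤ)
  | 0 => fun x => Function.update x 0 (-x 0)
  | k + 1 => fun x => x ∘ Equiv.swap k (k + 1)

theorem act_zero_apply (x : ℕ → ℤ) (i : ℕ) : act 0 x i = if i = 0 then -x 0 else x i := by
  simp [act, Function.update_apply]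

theorem act_succ_apply (k : ℕ) (x : ℕ → ℤ) (i : ℕ) :
    act (k + 1) x i = if i = k then x (k + 1) else if i = k + 1 then x k else x i := by
  simp only [act, Function.comp_apply, Equiv.swap_apply_def]
  split_ifs <;> rfl

theorem act_mul_self (k : ℕ) : act k * act k = 1 := by
  funext x i
  change act k (act k x) i = x i
  cases k with
  | zero => simp only [act_zero_apply]; grind
  | succ k => simp only [act_succ_apply]; grind

theorem act_zero_one : (act 0 * act 1) ^ 4 = 1 := by
  funext x i
  change act 0 (act 1 (act 0 (act 1 (act 0 (act 1 (act 0 (act 1 x))))))) i = x i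
  simp only [act_zero_apply, act_succ_apply 0]
  grind

theorem act_succ_succ (k : ℕ) : (act (k + 1) * act (k + 2)) ^ 3 = 1 := by
  funext x i
  change act (k + 1) (act (k + 2) (act (k + 1) (act (k + 2) (act (k + 1) (act (k + 2) x))))) i = x i
  simp only [act_succ_apply]
  grind

theorem act_comm {j k : ℕ} (h : j + 1 < k) : (act j * act k) ^ 2 = 1 := by
  funext x i
  change act j (act k (act j (act k x))) i = x i
  obtain ⟨k, rfl⟩ := Nat.exists_eq_succ_of_ne_zero (by omega : k ≠ 0)
  cases j with
  | zero => simp only [act_zero_apply, Nat.succ_eq_add_one, act_succ_apply]; grind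
  | succ j => simp only [Nat.succ_eq_add_one, act_succ_apply]; grind

theorem mul_pow_eq_one_of_swap {G : Type*} [Monoid G] {a b : G} (ha : a * a = 1)
    {m : ℕ} (h : (a * b) ^ m = 1) : (b * a) ^ m = 1 := by
  have hs : a * (b * a) ^ m = (a * b) ^ m * a :=
    SemiconjBy.pow_right (show SemiconjBy a (b * a) (a * b) by simp [SemiconjBy, mul_assoc]) m
  rw [h, one_mul] at hs
  calc (b * a) ^ m = a * (a * (b * a) ^ m) := by rw [← mul_assoc, ha, one_mul]
    _ = 1 := by rw [hs, ha]

/-- The number of type `B` inversions formed by an entry `a` standing before an entry `b`. -/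
def pairInv (a b : ℤ) : ℕ := (if b < a then 1 else 0) + if a + b < 0 then 1 else 0

/-- The number of type `B` inversions among the first `n` entries of an integer sequence. -/
def inv (n : ℕ) (x : ℕ → ℤ) : ℕ :=
  ∑ j ∈ Finset.range n, (∑ i ∈ Finset.range j, pairInv (x i) (x j) + if x j < 0 then 1 else 0)

theorem inv_succ (n : ℕ) (x : ℕ → ℤ) :
    inv (n + 1) x =
      inv n x + (∑ i ∈ Finset.range n, pairInv (x i) (x n) + if x n < 0 then 1 else 0) :=
  Finset.sum_range_succ _ _

theorem inv_mono (x : ℕ → ℤ) : Monotone fun n => inv n x :=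
  monotone_nat_of_le_succ fun n => by rw [inv_succ]; omega

theorem inv_congr {n : ℕ} {x y : ℕ → ℤ} (h : ∀ i < n, x i = y i) : inv n x = inv n y := by
  unfold inv
  refine Finset.sum_congr rfl fun j hj => ?_
  rw [Finset.mem_range] at hj
  rw [h j hj]
  congr 1
  refine Finset.sum_congr rfl fun i hi => ?_
  rw [Finset.mem_range] at hi
  rw [h i (hi.trans hj)]

theorem sum_pairInv_act {k n : ℕ} (hk : k < n) (x : ℕ → ℤ) (b : ℤ) :
    ∑ i ∈ Finset.range n, pairInv (act k x i) b = ∑ i ∈ Finset.range n, pairInv (x i) b := by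
  induction n, hk using Nat.le_induction with
  | base =>
    cases k with
    | zero => simp [act_zero_apply, pairInv]; grind
    | succ k =>
      have hlow : ∑ i ∈ Finset.range k, pairInv (act (k + 1) x i) b =
          ∑ i ∈ Finset.range k, pairInv (x i) b := by
        refine Finset.sum_congr rfl fun i hi => ?_
        rw [Finset.mem_range] at hi
        rw [act_succ_apply, if_neg (by omega), if_neg (by omega)]
      have h1 : act (k + 1) x k = x (k + 1) := by simp [act_succ_apply]
      have h2 : act (k + 1) x (k + 1) = x k := by simp [act_succ_apply]
      simp only [Nat.succ_eq_add_one, Finset.sum_range_succ, hlow, h1, h2]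
      omega
  | succ n hn ih =>
    have hfix : act k x n = x n := by
      cases k with
      | zero => rw [act_zero_apply, if_neg (by omega)]
      | succ k => rw [act_succ_apply, if_neg (by omega), if_neg (by omega)]
    rw [Finset.sum_range_succ, Finset.sum_range_succ, ih, hfix]

theorem inv_act_succ_base (k : ℕ) (x : ℕ → ℤ) :
    inv (k + 2) (act (k + 1) x) + pairInv (x k) (x (k + 1)) =
      inv (k + 2) x + pairInv (x (k + 1)) (x k) := by
  have hlow : ∀ i < k, act (k + 1) x i = x i := fun i hi => by
    rw [act_succ_apply, if_neg (by omega), if_neg (by omega)]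
  have hsum : ∀ b, ∑ i ∈ Finset.range k, pairInv (act (k + 1) x i) b =
      ∑ i ∈ Finset.range k, pairInv (x i) b := fun b =>
    Finset.sum_congr rfl fun i hi => by rw [hlow i (Finset.mem_range.mp hi)]
  have h1 : act (k + 1) x k = x (k + 1) := by simp [act_succ_apply]
  have h2 : act (k + 1) x (k + 1) = x k := by simp [act_succ_apply]
  simp only [inv_succ, Finset.sum_range_succ, hsum, inv_congr hlow, h1, h2]
  omega

theorem inv_act_le {k n : ℕ} (hk : k < n) (x : ℕ → ℤ) : inv n (act k x) ≤ inv n x + 1 := by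
  induction n, hk using Nat.le_induction with
  | base =>
    cases k with
    | zero => simp [inv, act_zero_apply]; grind
    | succ k =>
      have h := inv_act_succ_base k x
      have hp : pairInv (x (k + 1)) (x k) ≤ pairInv (x k) (x (k + 1)) + 1 := by
        unfold pairInv; grind
      change inv (k + 2) _ ≤ inv (k + 2) _ + 1
      omega
  | succ n hn ih =>
    have hfix : act k x n = x n := by
      cases k with
      | zero => rw [act_zero_apply, if_neg (by omega)]
      | succ k => rw [act_succ_apply, if_neg (by omega), if_neg (by omega)]
    rw [inv_succ, inv_succ, hfix, sum_pairInv_act hn]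
    omega

/-- A sequence that agrees with `1, 2, 3, …` from position `k` on and whose first `k` entries
have absolute value at most `k`. -/
def IsStable (k : ℕ) (x : ℕ → ℤ) : Prop :=
  (∀ i < k, |x i| ≤ k) ∧ ∀ i, k ≤ i → x i = i + 1

theorem isStable_zero : IsStable 0 fun i => (i : ℤ) + 1 := ⟨by simp, by simp⟩

theorem IsStable.mono {j k : ℕ} (h : j ≤ k) {x : ℕ → ℤ} (hx : IsStable j x) : IsStable k x := by
  refine ⟨fun i hi => ?_, fun i hi => hx.2 i (h.trans hi)⟩
  rcases lt_or_ge i j with hij | hij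
  · exact (hx.1 i hij).trans (by exact_mod_cast h)
  · rw [hx.2 i hij, abs_of_nonneg (by positivity)]
    exact_mod_cast hi

theorem IsStable.act_succ {k : ℕ} {x : ℕ → ℤ} (hx : IsStable (k + 1) x) :
    IsStable (k + 2) (act (k + 1) x) ∧ inv (k + 2) (act (k + 1) x) = inv (k + 1) x + 1 := by
  have hx' := hx.mono (Nat.le_succ (k + 1))
  constructor
  · refine ⟨fun i hi => ?_, fun i hi => ?_⟩
    · rw [act_succ_apply]
      split_ifs
      exacts [hx'.1 _ (by omega), hx'.1 _ (by omega), hx'.1 _ hi]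
    · rw [act_succ_apply, if_neg (by omega), if_neg (by omega)]
      exact hx'.2 i hi
  · have h := inv_act_succ_base k x
    have htop : x (k + 1) = k + 2 := by rw [hx.2 _ le_rfl]; push_cast; ring
    have hzero : ∑ i ∈ Finset.range (k + 1), pairInv (x i) (x (k + 1)) = 0 := by
      refine Finset.sum_eq_zero fun i hi => ?_
      have := abs_le.mp (hx.1 i (Finset.mem_range.mp hi))
      unfold pairInv
      rw [if_neg (by push_cast at this; omega), if_neg (by push_cast at this; omega), add_zero]
    have hk := abs_le.mp (hx.1 k (by omega))
    push_cast at hk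
    have h1 : pairInv (x k) (x (k + 1)) = 0 := by
      unfold pairInv; rw [if_neg (by omega), if_neg (by omega)]
    have h2 : pairInv (x (k + 1)) (x k) = 1 := by
      unfold pairInv; rw [if_pos (by omega), if_neg (by omega)]
    rw [h1, h2, inv_succ (k + 1) x, hzero, if_neg (by omega)] at h
    omega

theorem IsStable.negate {k : ℕ} {x : ℕ → ℤ} (hx : IsStable k x) :
    IsStable (k + 1) (Function.update x k (-x k)) ∧
      inv (k + 1) (Function.update x k (-x k)) = inv k x + (2 * k + 1) := by
  have hx' := hx.mono (Nat.le_succ k)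
  have hlow : ∀ i < k, Function.update x k (-x k) i = x i := fun i hi => by
    rw [Function.update_of_ne hi.ne]
  have htop : x k = k + 1 := hx.2 k le_rfl
  constructor
  · refine ⟨fun i hi => ?_, fun i hi => ?_⟩
    · rcases eq_or_ne i k with rfl | hne
      · rw [Function.update_self, abs_neg]; exact hx'.1 _ hi
      · rw [Function.update_of_ne hne]; exact hx'.1 _ hi
    · rw [Function.update_of_ne (by omega)]; exact hx'.2 i hi
  · have hsum : ∑ i ∈ Finset.range k, pairInv (Function.update x k (-x k) i) (-x k) =
        ∑ i ∈ Finset.range k, 2 := by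
      refine Finset.sum_congr rfl fun i hi => ?_
      have hi := Finset.mem_range.mp hi
      have := abs_le.mp (hx.1 i hi)
      rw [hlow i hi]
      unfold pairInv
      rw [if_pos (by omega), if_pos (by omega)]
    rw [inv_succ, inv_congr hlow, Function.update_self, hsum, if_pos (by omega)]
    simp
    omega

end SignedPerm

namespace CoxeterSystem

open SignedPerm

variable {n : ℕ} {W : Type*} [Group W] {M : CoxeterMatrix (Fin n)} (cs : CoxeterSystem M W)

theorem gen_of_lt {k : ℕ} (hk : k < n) : cs.gen k = cs.simple ⟨k, hk⟩ := dif_pos hk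

theorem isReflection_gen {k : ℕ} (hk : k < n) : cs.IsReflection (cs.gen k) := by
  rw [cs.gen_of_lt hk]
  exact cs.isReflection_simple _

theorem isReflection_shatB {k : ℕ} (hk : k < n) : cs.IsReflection (cs.shatB k) := by
  induction k with
  | zero => exact cs.isReflection_gen hk
  | succ k ih =>
    have h := (ih (by omega)).conj (cs.gen (k + 1))
    rwa [(cs.isReflection_gen hk).inv] at h

theorem length_gen {k : ℕ} (hk : k < n) : cs.length (cs.gen k) = 1 := by
  rw [cs.gen_of_lt hk, cs.length_simple]

theorem length_shatB_le {k : ℕ} (hk : k < n) : cs.length (cs.shatB k) ≤ 2 * k + 1 := by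
  induction k with
  | zero => exact (cs.length_gen hk).le
  | succ k ih =>
    have h1 := cs.length_mul_le (cs.gen (k + 1) * cs.shatB k) (cs.gen (k + 1))
    have h2 := cs.length_mul_le (cs.gen (k + 1)) (cs.shatB k)
    have h3 := cs.length_gen hk
    have h4 := ih (by omega)
    change cs.length (cs.gen (k + 1) * cs.shatB k * cs.gen (k + 1)) ≤ _
    omega

theorem gen_mem_parabolic {k m : ℕ} (hk : k < n) (hm : k < m) :
    cs.gen k ∈ cs.parabolic {j : Fin n | (j : ℕ) < m} := by
  rw [cs.gen_of_lt hk]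
  exact Subgroup.subset_closure ⟨_, hm, rfl⟩

theorem shatB_mem_parabolic {k m : ℕ} (hk : k < n) (hm : k < m) :
    cs.shatB k ∈ cs.parabolic {j : Fin n | (j : ℕ) < m} := by
  induction k with
  | zero => exact cs.gen_mem_parabolic hk hm
  | succ k ih =>
    have h := cs.gen_mem_parabolic hk hm
    exact mul_mem (mul_mem h (ih (by omega) (by omega))) h

/-- The Coxeter matrix of type `Bₙ` is satisfied by the signed permutation action. -/
theorem isLiftable_act
    (hM4 : ∀ (h0 : 0 < n) (h1 : 1 < n), M ⟨0, h0⟩ ⟨1, h1⟩ = 4)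
    (hM3 : ∀ (k : ℕ) (h : k + 1 < n) (h' : k + 2 < n), M ⟨k + 1, h⟩ ⟨k + 2, h'⟩ = 3)
    (hM2 : ∀ i j : Fin n, (i : ℕ) + 1 < (j : ℕ) → M i j = 2) :
    M.IsLiftable fun i : Fin n => act i := by
  have key : ∀ i j : Fin n, i < j → (act i * act j) ^ M i j = 1 := by
    rintro ⟨i, hi⟩ ⟨j, hj⟩ hij
    have hij : i < j := hij
    rcases (Nat.succ_le_of_lt hij).lt_or_eq with h | rfl
    · rw [hM2 _ _ h]
      exact act_comm h
    · cases i with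
      | zero => rw [hM4 hi hj]; exact act_zero_one
      | succ i => rw [hM3 i hi hj]; exact act_succ_succ i
  intro i j
  rcases lt_trichotomy i j with h | rfl | h
  · exact key i j h
  · rw [M.diagonal, pow_one]
    exact act_mul_self i
  · rw [M.symmetric]
    exact mul_pow_eq_one_of_swap (act_mul_self j) (key j i h)

theorem inv_le_length {φ : W →* Function.End (ℕ → ℤ)} (hφ : ∀ i : Fin n, φ (cs.simple i) = act i)
    (w : W) : inv n (φ w fun i => (i : ℤ) + 1) ≤ cs.length w := by
  obtain ⟨ω, hω, rfl⟩ := cs.exists_isReduced w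
  rw [hω.eq]
  clear hω
  induction ω with
  | nil =>
    rw [cs.wordProd_nil, map_one]
    refine (Finset.sum_eq_zero fun j _ => ?_).le
    change ∑ i ∈ Finset.range j, pairInv ((i : ℤ) + 1) (j + 1) +
      (if (j : ℤ) + 1 < 0 then 1 else 0) = 0
    rw [Finset.sum_eq_zero fun i hi => ?_, if_neg (by omega)]
    have := Finset.mem_range.mp hi
    unfold pairInv
    rw [if_neg (by omega), if_neg (by omega), add_zero]
  | cons a ω ih =>
    rw [cs.wordProd_cons, map_mul, hφ]
    exact (inv_act_le a.isLt _).trans (Nat.add_le_add_right ih 1)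

theorem map_shatB {φ : W →* Function.End (ℕ → ℤ)} (hφ : ∀ i : Fin n, φ (cs.simple i) = act i)
    {k : ℕ} (hk : k < n) (x : ℕ → ℤ) : φ (cs.shatB k) x = Function.update x k (-x k) := by
  induction k generalizing x with
  | zero =>
    change φ (cs.gen 0) x = _
    rw [cs.gen_of_lt hk, hφ]
    rfl
  | succ k ih =>
    change φ (cs.gen (k + 1) * cs.shatB k * cs.gen (k + 1)) x = _
    rw [map_mul, map_mul, cs.gen_of_lt hk, hφ]
    change act (k + 1) (φ (cs.shatB k) (act (k + 1) x)) = _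
    rw [ih (by omega)]
    funext i
    simp only [act_succ_apply, Function.update_apply]
    grind

/-- `w` carries stable sequences of level `k` to stable sequences of level `k + 1`, creating at
least `ℓ(w)` new inversions. -/
def Raises (φ : W →* Function.End (ℕ → ℤ)) (k : ℕ) (w : W) : Prop :=
  ∀ x, IsStable k x →
    IsStable (k + 1) (φ w x) ∧ inv k x + cs.length w ≤ inv (k + 1) (φ w x)

theorem raises_shatB {φ : W →* Function.End (ℕ → ℤ)} (hφ : ∀ i : Fin n, φ (cs.simple i) = act i)
    {k : ℕ} (hk : k < n) : cs.Raises φ k (cs.shatB k) := by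
  intro x hx
  rw [cs.map_shatB hφ hk, hx.negate.2]
  exact ⟨hx.negate.1, Nat.add_le_add_left (cs.length_shatB_le hk) _⟩

theorem raises_gen {φ : W →* Function.End (ℕ → ℤ)} (hφ : ∀ i : Fin n, φ (cs.simple i) = act i)
    {k : ℕ} (hk : k < n) : cs.Raises φ k (cs.gen k) := by
  cases k with
  | zero => exact cs.raises_shatB hφ hk
  | succ k =>
    intro x hx
    rw [cs.length_gen hk, cs.gen_of_lt hk, hφ]
    exact ⟨hx.act_succ.1, hx.act_succ.2.ge⟩

theorem Raises.length_lt_length_simple_mul {φ : W →* Function.End (ℕ → ℤ)}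
    (hφ : ∀ i : Fin n, φ (cs.simple i) = act i) {k : ℕ} (hk : k < n) {w : W}
    (hr : cs.IsReflection w) (hw : cs.Raises φ k w) {j : Fin n} (hj : (j : ℕ) < k) :
    cs.length w < cs.length (cs.simple j * w) := by
  have hj1 := cs.raises_gen hφ j.isLt _ (isStable_zero.mono (Nat.zero_le j))
  rw [cs.length_gen j.isLt, cs.gen_of_lt j.isLt] at hj1
  have hj2 := hw _ (hj1.1.mono hj)
  have hmono := inv_mono (φ (cs.simple j) fun i => (i : ℤ) + 1) (Nat.succ_le_of_lt hj)
  have htop := inv_mono (φ w (φ (cs.simple j) fun i => (i : ℤ) + 1)) (Nat.succ_le_of_lt hk)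
  have hlen := cs.inv_le_length hφ (w * cs.simple j)
  rw [map_mul] at hlen
  change inv n (φ w (φ (cs.simple j) _)) ≤ _ at hlen
  rw [← cs.length_inv, mul_inv_rev, hr.inv, cs.inv_simple] at hlen
  simp only [Nat.succ_eq_add_one] at hmono htop
  have h1 := hj1.2
  have h2 := hj2.2
  simp only [Fin.eta] at h1 h2
  omega

theorem length_prod_eq_sum {φ : W →* Function.End (ℕ → ℤ)}
    (hφ : ∀ i : Fin n, φ (cs.simple i) = act i) {ts : ℕ → W}
    (hr : ∀ k < n, cs.IsReflection (ts k)) (hts : ∀ k < n, cs.Raises φ k (ts k)) :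
    cs.length ((List.range n).map ts).prod = ∑ k ∈ Finset.range n, cs.length (ts k) := by
  have hle : ∀ m, cs.length ((List.range m).map ts).prod ≤
      ∑ k ∈ Finset.range m, cs.length (ts k) := by
    intro m
    induction m with
    | zero => simp
    | succ m ih =>
      rw [List.range_succ, List.map_append, List.prod_append, Finset.sum_range_succ]
      simpa using (cs.length_mul_le _ _).trans (Nat.add_le_add_right ih _)
  have hge : ∀ m ≤ n,
      IsStable m (φ ((List.range m).map ts).prod⁻¹ fun i => (i : ℤ) + 1) ∧
      ∑ k ∈ Finset.range m, cs.length (ts k) ≤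
        inv m (φ ((List.range m).map ts).prod⁻¹ fun i => (i : ℤ) + 1) := by
    intro m hm
    induction m with
    | zero =>
      rw [List.range_zero, List.map_nil, List.prod_nil, inv_one, map_one]
      exact ⟨isStable_zero, Nat.zero_le _⟩
    | succ m ih =>
      have h := hts m hm _ (ih (by omega)).1
      have h' := (ih (by omega)).2
      rw [List.range_succ, List.map_append, List.prod_append, mul_inv_rev, map_mul,
        Finset.sum_range_succ, List.map_singleton, List.prod_singleton, (hr m hm).inv]
      exact ⟨h.1, (Nat.add_le_add_right h' _).trans h.2⟩
  refine (hle n).antisymm ((hge n le_rfl).2.trans ?_)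
  rw [← cs.length_inv]
  exact cs.inv_le_length hφ _

/-- The sequence of reflections, indexed from `0`, attached to a sequence of `h` parts: `ŝ_k` at the
starting positions `k` of the blocks and `s_k` elsewhere. -/
noncomputable def blockFactor (h : ℕ) (α : ℕ → ℕ) (k : ℕ) : W :=
  open Classical in if ∃ r < h, partSum α (r + 1) = k then cs.shatB k else cs.gen k

theorem partSum_succ (α : ℕ → ℕ) (r : ℕ) :
    partSum α (r + 2) = partSum α (r + 1) + α (r + 1) :=
  Finset.sum_Ico_succ_top (by omega) α

theorem partSum_mono (α : ℕ → ℕ) : Monotone (partSum α) := fun _ _ h =>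
  Finset.sum_le_sum_of_subset (Finset.Ico_subset_Ico_right h)

theorem blockFactor_eq_or (h : ℕ) (α : ℕ → ℕ) (k : ℕ) :
    cs.blockFactor h α k = cs.gen k ∨ cs.blockFactor h α k = cs.shatB k := by
  unfold blockFactor
  split_ifs
  exacts [.inr rfl, .inl rfl]

theorem negBlockB_eq_prod_blockFactor {h : ℕ} {α : ℕ → ℕ} {r : ℕ} (hr : r < h)
    (hpos : 1 ≤ α (r + 1)) :
    cs.negBlockB (partSum α (r + 1)) (α (r + 1)) =
      ((List.range (α (r + 1))).map fun k => cs.blockFactor h α (partSum α (r + 1) + k)).prod := by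
  have hsucc := partSum_succ α r
  obtain ⟨d, hd⟩ := Nat.exists_eq_add_of_le' hpos
  rw [hd] at hsucc ⊢
  rw [List.range_succ_eq_map, List.map_cons, List.prod_cons, List.map_map, negBlockB,
    Nat.add_sub_cancel, add_zero]
  congr 1
  · exact (if_pos ⟨r, hr, rfl⟩).symm
  · congr 1
    refine List.map_congr_left fun k hk => ?_
    have hk := List.mem_range.mp hk
    simp only [Function.comp_apply, Nat.succ_eq_add_one]
    rw [show partSum α (r + 1) + (k + 1) = partSum α (r + 1) + 1 + k by omega]
    refine (if_neg ?_).symm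
    rintro ⟨q, -, hq⟩
    rcases le_or_gt q r with hqr | hqr
    · have := partSum_mono α (Nat.add_le_add_right hqr 1)
      omega
    · have := partSum_mono α (show r + 2 ≤ q + 1 by omega)
      omega

theorem prod_negBlockB_eq {h : ℕ} {α : ℕ → ℕ} (hpos : ∀ i, 1 ≤ i → i ≤ h → 1 ≤ α i)
    {r : ℕ} (hr : r ≤ h) :
    ((List.range r).map fun i => cs.negBlockB (partSum α (i + 1)) (α (i + 1))).prod =
      ((List.range (partSum α (r + 1))).map (cs.blockFactor h α)).prod := by
  induction r with
  | zero => simp [partSum]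
  | succ r ih =>
    rw [List.range_succ, List.map_append, List.prod_append, ih (by omega), partSum_succ,
      List.range_add, List.map_append, List.prod_append, List.map_singleton, List.prod_singleton,
      List.map_map, cs.negBlockB_eq_prod_blockFactor hr (hpos _ (by omega) hr)]
    rfl

end CoxeterSystem

/-- Let `(W,S)` be of type `Bₙ` and let `α` be a partition of `n` with
nonzero parts `α₁ ≤ … ≤ α_h`.  Set `w_α = b⁻(m₁,α₁) ⋯ b⁻(m_h,α_h)`.  Then
`w_α = t₁ t₂ ⋯ t_n` where `t₁ = ŝ₀ = t` and `t_i ∈ {s_{i−1}, ŝ_{i−1}}` for `i ≥ 2`, each `t_i`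
is a reflection, `ℓ(w_α) = ℓ(t₁) + ⋯ + ℓ(t_n)`; moreover, with `J_i = {t, s₁, …, s_{i−1}}` and
`J₀ = ∅`, one has `t_i ∈ W_{J_i}` and `ℓ(s·t_i) > ℓ(t_i)` for all `s ∈ J_{i−1}`,
`1 ≤ i ≤ n`. -/
theorem walphaB_excellent_decomposition {n : ℕ} {W : Type*} [Group W] (hn : 2 ≤ n)
    {M : CoxeterMatrix (Fin n)}
    (hM4 : ∀ h1 : 1 < n, M ⟨0, by omega⟩ ⟨1, h1⟩ = 4)
    (hM3 : ∀ (k : ℕ) (h : k + 2 < n), M ⟨k + 1, by omega⟩ ⟨k + 2, h⟩ = 3)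
    (hM2 : ∀ i j : Fin n, (i : ℕ) + 1 < (j : ℕ) → M i j = 2)
    (cs : CoxeterSystem M W) (h : ℕ) (α : ℕ → ℕ) (hh : 1 ≤ h)
    (hpos : ∀ i, 1 ≤ i → i ≤ h → 1 ≤ α i)
    (hmono : ∀ i j, 1 ≤ i → i ≤ j → j ≤ h → α i ≤ α j)
    (hsum : ∑ i ∈ Finset.Icc 1 h, α i = n) :
    ∃ ts : ℕ → W,
      ((List.range h).map fun i => cs.negBlockB (partSum α (i + 1)) (α (i + 1))).prod =
        ((List.range n).map fun k => ts (k + 1)).prod ∧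
      ts 1 = cs.shatB 0 ∧
      (∀ i, 2 ≤ i → i ≤ n → ts i = cs.gen (i - 1) ∨ ts i = cs.shatB (i - 1)) ∧
      (∀ i, 1 ≤ i → i ≤ n → cs.IsReflection (ts i)) ∧
      cs.length (((List.range h).map fun i =>
          cs.negBlockB (partSum α (i + 1)) (α (i + 1))).prod) =
        ∑ i ∈ Finset.Icc 1 n, cs.length (ts i) ∧
      ∀ i, 1 ≤ i → i ≤ n →
        ts i ∈ cs.parabolic {j : Fin n | (j : ℕ) < i} ∧
        ∀ j : Fin n, (j : ℕ) < i - 1 →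
          cs.length (cs.simple j * ts i) > cs.length (ts i) := by
  have hlift := CoxeterSystem.isLiftable_act (fun _ => hM4) (fun k _ => hM3 k) hM2
  let φ : W →* Function.End (ℕ → ℤ) := cs.lift ⟨_, hlift⟩
  have hφ : ∀ i : Fin n, φ (cs.simple i) = SignedPerm.act i :=
    cs.lift_apply_simple hlift
  have hraise : ∀ k < n, cs.Raises φ k (cs.blockFactor h α k) := fun k hk => by
    rcases cs.blockFactor_eq_or h α k with e | e <;> rw [e]
    exacts [cs.raises_gen hφ hk, cs.raises_shatB hφ hk]
  have hrefl : ∀ k < n, cs.IsReflection (cs.blockFactor h α k) := fun k hk => by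
    rcases cs.blockFactor_eq_or h α k with e | e <;> rw [e]
    exacts [cs.isReflection_gen hk, cs.isReflection_shatB hk]
  have hprod := cs.prod_negBlockB_eq hpos le_rfl
  rw [show partSum α (h + 1) = n from hsum] at hprod
  refine ⟨fun i => cs.blockFactor h α (i - 1), ?_, ?_, ?_, ?_, ?_, ?_⟩
  · simpa using hprod
  · exact if_pos ⟨0, hh, by simp [partSum]⟩
  · exact fun i _ _ => cs.blockFactor_eq_or h α (i - 1)
  · exact fun i hi hin => hrefl _ (by omega)
  · rw [hprod, cs.length_prod_eq_sum hφ hrefl hraise, Finset.range_eq_Ico]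
    exact Finset.sum_Ico_add' (fun i => cs.length (cs.blockFactor h α (i - 1))) 0 n 1
  · intro i hi hin
    refine ⟨?_, fun j hj => ?_⟩
    · rcases cs.blockFactor_eq_or h α (i - 1) with e | e <;> simp only [e]
      exacts [cs.gen_mem_parabolic (by omega) (by omega),
        cs.shatB_mem_parabolic (by omega) (by omega)]
    · exact (hraise (i - 1) (by omega)).length_lt_length_simple_mul cs hφ (by omega)
        (hrefl _ (by omega)) hj
end
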